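/- If G is a planar graph on n vertices with girth at least 5 (i.e., G has no cycle of length 3 or 4), then γ'_R(G) ≤ (4/5)·n. (Here planarity may be taken in the Kuratowski form: G contains no subgraph isomorphic to a subdivision of K_5 or of K_{3,3}.) -/

import Mathlib

open Finset SimpleGraph

/-- An edge Roman dominating function: values in {0,1,2} on edges (0 elsewhere),
and every edge with value 0 is adjacent to a distinct edge with value 2
sharing an endpoint with it. -/
def EdgeRDF {V : Type*} (G : SimpleGraph V) (f : Sym2 V → ℕ) : Prop :=
  (∀ e, f e ≤ 2) ∧ (∀ e, e ∉ G.edgeSet → f e = 0) ∧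
  (∀ e ∈ G.edgeSet, f e = 0 →
    ∃ e' ∈ G.edgeSet, f e' = 2 ∧ e' ≠ e ∧ ∃ v, v ∈ e ∧ v ∈ e')

/-- The edge Roman domination number: the minimum weight of an
edge Roman dominating function. -/
noncomputable def edgeRomanNumber (V : Type*) [Fintype V] [DecidableEq V]
    (G : SimpleGraph V) : ℕ :=
  sInf {w | ∃ f : Sym2 V → ℕ, EdgeRDF G f ∧ w = ∑ e : Sym2 V, f e}


/-- `G` contains a subgraph isomorphic to a subdivision of `H`: there is an injection
`f` of the vertices of `H` (the branch vertices) into `G` and, for each edge of `H`,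
a path in `G` between the corresponding branch vertices, such that the only branch
vertices on each such path are its two endpoints, and paths corresponding to distinct
edges of `H` share only branch vertices. -/
def ContainsSubdivision {V U : Type*} (G : SimpleGraph V) (H : SimpleGraph U) : Prop :=
  ∃ f : U → V, Function.Injective f ∧
    ∃ P : ∀ ⦃u w : U⦄, H.Adj u w → G.Walk (f u) (f w),
      (∀ ⦃u w : U⦄ (h : H.Adj u w), (P h).IsPath) ∧
      (∀ ⦃u w : U⦄ (h : H.Adj u w), ∀ x ∈ (P h).support,
        x ∈ Set.range f → x = f u ∨ x = f w) ∧
      (∀ ⦃u w : U⦄ (h : H.Adj u w) ⦃u' w' : U⦄ (h' : H.Adj u' w'),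
        s(u, w) ≠ s(u', w') →
          ∀ x ∈ (P h).support, x ∈ (P h').support → x ∈ Set.range f)


/-- A nonempty vertex set inducing a connected subgraph. -/
def SetConn {V : Type*} (G : SimpleGraph V) (S : Set V) : Prop :=
  S.Nonempty ∧ ∀ x ∈ S, ∀ y ∈ S,
    Relation.ReflTransGen (fun u v => G.Adj u v ∧ u ∈ S ∧ v ∈ S) x y

namespace SetConn

variable {V : Type*} {G : SimpleGraph V} {S T : Set V}

lemma rel_symm {x y : V}
    (h : Relation.ReflTransGen (fun u v => G.Adj u v ∧ u ∈ S ∧ v ∈ S) x y) :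
    Relation.ReflTransGen (fun u v => G.Adj u v ∧ u ∈ S ∧ v ∈ S) y x := by
  induction h with
  | refl => exact .refl
  | tail _ h ih => exact .head ⟨h.1.symm, h.2.2, h.2.1⟩ ih

lemma rel_mono (hST : S ⊆ T) {x y : V}
    (h : Relation.ReflTransGen (fun u v => G.Adj u v ∧ u ∈ S ∧ v ∈ S) x y) :
    Relation.ReflTransGen (fun u v => G.Adj u v ∧ u ∈ T ∧ v ∈ T) x y :=
  Relation.ReflTransGen.mono (fun _ _ h => ⟨h.1, hST h.2.1, hST h.2.2⟩) _ _ h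

lemma of_root {x : V} (hx : x ∈ S)
    (h : ∀ y ∈ S, Relation.ReflTransGen (fun u v => G.Adj u v ∧ u ∈ S ∧ v ∈ S) x y) :
    SetConn G S :=
  ⟨⟨x, hx⟩, fun y hy z hz => (rel_symm (h y hy)).trans (h z hz)⟩

lemma mono_graph {G' : SimpleGraph V} (h : SetConn G S)
    (hG : ∀ x ∈ S, ∀ y ∈ S, G.Adj x y → G'.Adj x y) : SetConn G' S :=
  ⟨h.1, fun x hx y hy => Relation.ReflTransGen.mono
    (fun _ _ h => ⟨hG _ h.2.1 _ h.2.2 h.1, h.2⟩) _ _ (h.2 x hx y hy)⟩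

lemma singleton (x : V) : SetConn G {x} :=
  of_root rfl fun _ hy => by rw [hy]

lemma union_inter (hS : SetConn G S) (hT : SetConn G T) {x : V} (hxS : x ∈ S) (hxT : x ∈ T) :
    SetConn G (S ∪ T) :=
  of_root (Or.inl hxS) fun y hy => hy.elim
    (fun hy => rel_mono Set.subset_union_left (hS.2 x hxS y hy))
    (fun hy => rel_mono Set.subset_union_right (hT.2 x hxT y hy))

lemma union_adj (hS : SetConn G S) (hT : SetConn G T) {x y : V} (hxS : x ∈ S) (hyT : y ∈ T)
    (hxy : G.Adj x y) : SetConn G (S ∪ T) :=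
  of_root (Or.inl hxS) fun z hz => hz.elim
    (fun hz => rel_mono Set.subset_union_left (hS.2 x hxS z hz))
    (fun hz => .head ⟨hxy, Or.inl hxS, Or.inr hyT⟩
      (rel_mono Set.subset_union_right (hT.2 y hyT z hz)))

lemma insert_adj (hS : SetConn G S) {x y : V} (hyS : y ∈ S) (hxy : G.Adj x y) :
    SetConn G (insert x S) :=
  (singleton x).union_adj hS rfl hyS hxy

lemma of_isChain {x : V} {l : List V} (h : (x :: l).IsChain G.Adj) :
    SetConn G {y | y ∈ x :: l} := by
  induction l generalizing x with
  | nil => simpa using singleton x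
  | cons y l ih =>
    rw [List.isChain_cons_cons] at h
    convert (ih h.2).insert_adj (x := x) (by simp) h.1 using 1
    ext z; simp

lemma of_isChain' {l : List V} (h : l.IsChain G.Adj) (hl : l ≠ []) :
    SetConn G {y | y ∈ l} := by
  obtain ⟨x, l, rfl⟩ := List.exists_cons_of_ne_nil hl
  exact of_isChain h

/-- In a connected set, a path from a given vertex to a target set, stopping at the first hit. -/
lemma exists_firstHit (hS : SetConn G S) (hTS : T ⊆ S) (hT : T.Nonempty) {z : V} (hz : z ∈ S) :
    ∃ t ∈ T, ∃ l : List V, (t :: l).IsChain G.Adj ∧ (t :: l).Nodup ∧ (∀ x ∈ t :: l, x ∈ S) ∧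
      (t :: l).getLast? = some z ∧ ∀ x ∈ l, x ∉ T := by
  obtain ⟨t, ht⟩ := hT
  have h := hS.2 t (hTS ht) z hz
  induction h with
  | refl => exact ⟨t, ht, [], by simp, by simp, by simpa using hTS ht, rfl, by simp⟩
  | @tail y z' _ hyz ih =>
    by_cases hz' : z' ∈ T
    · exact ⟨z', hz', [], by simp, by simp, by simpa using hz, rfl, by simp⟩
    obtain ⟨u, hu, l, hc, hn, hlS, hlast, hlT⟩ := ih hyz.2.1
    by_cases hmem : z' ∈ u :: l
    · have hne : z' ≠ u := by rintro rfl; exact hz' hu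
      obtain ⟨A, B, rfl⟩ := List.append_of_mem ((List.mem_cons.1 hmem).resolve_left hne)
      have e : u :: (A ++ z' :: B) = (u :: (A ++ [z'])) ++ B := by simp
      rw [e] at hc hn hlS
      refine ⟨u, hu, A ++ [z'], (List.isChain_append.1 hc).1, (List.nodup_append.1 hn).1,
        fun x hx => hlS x (List.mem_append_left _ hx), by simp [List.getLast?_cons],
        fun x hx => hlT x ?_⟩
      simp only [List.mem_append, List.mem_cons, List.not_mem_nil, or_false] at hx ⊢
      tauto
    · have e : u :: (l ++ [z']) = (u :: l) ++ [z'] := by simp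
      refine ⟨u, hu, l ++ [z'], ?_, ?_, ?_, by simp [List.getLast?_cons], ?_⟩
      · rw [e, List.isChain_append]
        refine ⟨hc, by simp, ?_⟩
        rw [hlast]
        simpa using hyz.1
      · rw [e, List.nodup_append]
        refine ⟨hn, by simp, ?_⟩
        rintro a ha b hb rfl
        rw [List.mem_singleton.1 hb] at ha
        exact hmem ha
      · intro x hx
        rw [e, List.mem_append] at hx
        rcases hx with hx | hx
        · exact hlS x hx
        · rw [List.mem_singleton.1 hx]; exact hz
      · intro x hx
        rcases List.mem_append.1 hx with hx | hx
        · exact hlT x hx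
        · rw [List.mem_singleton.1 hx]; exact hz'

lemma exists_path (hS : SetConn G S) {x y : V} (hx : x ∈ S) (hy : y ∈ S) :
    ∃ l : List V, (x :: l).IsChain G.Adj ∧ (x :: l).Nodup ∧ (∀ z ∈ x :: l, z ∈ S) ∧
      (x :: l).getLast? = some y := by
  obtain ⟨t, rfl, l, h1, h2, h3, h4, -⟩ :=
    hS.exists_firstHit (T := {x}) (by simpa using hx) (Set.singleton_nonempty x) hy
  exact ⟨l, h1, h2, h3, h4⟩

lemma exists_walk (hS : SetConn G S) {x y : V} (hx : x ∈ S) (hy : y ∈ S) :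
    ∃ p : G.Walk x y, p.IsPath ∧ ∀ z ∈ p.support, z ∈ S := by
  classical
  obtain ⟨p, hp⟩ : ∃ p : G.Walk x y, ∀ z ∈ p.support, z ∈ S := by
    have h := hS.2 x hx y hy
    clear hy
    induction h with
    | refl => exact ⟨.nil, by simpa using hx⟩
    | @tail b c _ h ih =>
      obtain ⟨p, hp⟩ := ih
      refine ⟨p.concat h.1, fun z hz => ?_⟩
      rw [Walk.support_concat, List.mem_append, List.mem_singleton] at hz
      rcases hz with hz | hz
      · exact hp z hz
      · rw [hz]; exact h.2.2
  exact ⟨p.bypass, p.bypass_isPath, fun z hz => hp z (p.support_bypass_subset_support hz)⟩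

end SetConn

/-- The component of `x` in the subgraph induced on `S`. -/
def setComp {V : Type*} (G : SimpleGraph V) (S : Set V) (x : V) : Set V :=
  {y | Relation.ReflTransGen (fun u v => G.Adj u v ∧ u ∈ S ∧ v ∈ S) x y}

section setComp

variable {V : Type*} {G : SimpleGraph V} {S : Set V} {x : V}

lemma mem_setComp_self : x ∈ setComp G S x := Relation.ReflTransGen.refl

lemma setComp_subset (hx : x ∈ S) : setComp G S x ⊆ S := by
  intro y hy
  induction hy with
  | refl => exact hx
  | tail _ h _ => exact h.2.2

lemma setComp_closed {y z : V} (hx : x ∈ S) (hy : y ∈ setComp G S x) (hyz : G.Adj y z)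
    (hz : z ∈ S) : z ∈ setComp G S x :=
  Relation.ReflTransGen.tail hy ⟨hyz, setComp_subset hx hy, hz⟩

lemma setConn_setComp : SetConn G (setComp G S x) := by
  refine SetConn.of_root mem_setComp_self fun y hy => ?_
  have hy' : Relation.ReflTransGen _ x y := hy
  clear hy
  induction hy' with
  | refl => exact .refl
  | tail h1 h2 ih => exact .tail ih ⟨h2.1, h1, h1.tail h2⟩

end setComp

section Star

variable {V U : Type*} {G : SimpleGraph V} {S : Set V}

/-- Inside `S` there are connected pieces reaching the portals `p w` for `w ∈ N`, pairwise meeting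
only in a common centre `c`. -/
def IsStarAt (G : SimpleGraph V) (S : Set V) (N : Set U) (p : U → V) (c : V) (Q : U → Set V) :
    Prop :=
  c ∈ S ∧ (∀ w ∈ N, Q w ⊆ S ∧ c ∈ Q w ∧ p w ∈ Q w ∧ SetConn G (Q w)) ∧
    ∀ w ∈ N, ∀ w' ∈ N, w ≠ w' → ∀ x ∈ Q w, x ∈ Q w' → x = c

lemma SetConn.exists_tripod (hS : SetConn G S) {x y z : V} (hx : x ∈ S) (hy : y ∈ S)
    (hz : z ∈ S) :
    ∃ c L₁ L₂ L₃, (c :: (L₁ ++ (L₂ ++ L₃))).Nodup ∧ (∀ w ∈ c :: (L₁ ++ (L₂ ++ L₃)), w ∈ S) ∧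
      (c :: L₁).IsChain G.Adj ∧ (c :: L₂).IsChain G.Adj ∧ (c :: L₃).IsChain G.Adj ∧
      (c :: L₁).getLast? = some x ∧ (c :: L₂).getLast? = some y ∧
      (c :: L₃).getLast? = some z := by
  obtain ⟨l, hc, hn, hlS, hlast⟩ := hS.exists_path hx hy
  obtain ⟨c, hcT, m, hmc, hmn, hmS, hmlast, hmT⟩ :=
    hS.exists_firstHit (T := {v | v ∈ x :: l}) hlS ⟨x, by simp⟩ hz
  obtain ⟨A, B, hAB⟩ := List.append_of_mem hcT
  have hh := congrArg List.head? hAB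
  simp only [Set.mem_ofPred_eq, hAB] at hmT hlS hn hc hlast
  have hr : c :: A.reverse = (A ++ [c]).reverse := by simp
  have hxA : (c :: A.reverse).getLast? = some x := by
    rw [hr, List.getLast?_reverse]
    rcases A with _ | ⟨a, A⟩ <;> simpa using hh.symm
  have hyB : (c :: B).getLast? = some y := by
    rwa [List.getLast?_append_cons] at hlast
  refine ⟨c, A.reverse, B, m, ?_, ?_, ?_, (List.isChain_split.1 hc).2, hmc, hxA, hyB, hmlast⟩
  · simp only [List.nodup_cons, List.nodup_append, List.mem_append, List.mem_cons,
      List.mem_reverse, List.nodup_reverse] at hn hmn hmT ⊢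
    grind
  · simp only [List.mem_cons, List.mem_append, List.mem_reverse] at hlS hmS ⊢
    grind
  · have := (List.isChain_split.1 hc).1
    rw [hr, List.isChain_reverse]
    exact this.imp fun _ _ h => h.symm

lemma SetConn.exists_isStarAt_three (hS : SetConn G S) {N : Set U} {p : U → V} {w₁ w₂ w₃ : U}
    (hN : ∀ w ∈ N, w = w₁ ∨ w = w₂ ∨ w = w₃) (hp : ∀ w, w = w₁ ∨ w = w₂ ∨ w = w₃ → p w ∈ S) :
    ∃ c Q, IsStarAt G S N p c Q := by
  classical
  obtain ⟨c, L₁, L₂, L₃, hn, hmem, h₁, h₂, h₃, k₁, k₂, k₃⟩ :=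
    hS.exists_tripod (hp w₁ (by simp)) (hp w₂ (by simp)) (hp w₃ (by simp))
  replace k₁ := List.mem_of_getLast? k₁
  replace k₂ := List.mem_of_getLast? k₂
  replace k₃ := List.mem_of_getLast? k₃
  refine ⟨c, fun w => {v | v ∈ c :: (if w = w₁ then L₁ else if w = w₂ then L₂ else L₃)}, ?_⟩
  refine ⟨hmem c (by simp), fun w hw => ⟨?_, by simp, ?_, SetConn.of_isChain ?_⟩, ?_⟩
  · intro v hv
    apply hmem
    simp only [Set.mem_ofPred_eq, List.mem_cons, List.mem_append] at hv ⊢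
    grind
  · simp only [Set.mem_ofPred_eq]
    rcases hN w hw with rfl | rfl | rfl <;> grind
  · rcases hN w hw with rfl | rfl | rfl <;> grind
  · intro w hw w' hw' hne x hx hx'
    simp only [Set.mem_ofPred_eq, List.mem_cons, List.nodup_cons, List.nodup_append,
      List.mem_append] at *
    rcases hN w hw with rfl | rfl | rfl <;> rcases hN w' hw' with rfl | rfl | rfl <;> grind

/-- `S` contains two disjoint adjacent connected sets, each with two of the four portals. -/
def HasSplit (G : SimpleGraph V) (S : Set V) (N : Set U) (p : U → V) : Prop :=
  ∃ A B : Set V, A ⊆ S ∧ B ⊆ S ∧ Disjoint A B ∧ SetConn G A ∧ SetConn G B ∧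
    (∃ x ∈ A, ∃ y ∈ B, G.Adj x y) ∧
    ∃ v₁ v₂ v₃ v₄ : U, [v₁, v₂, v₃, v₄].Nodup ∧ v₁ ∈ N ∧ v₂ ∈ N ∧ v₃ ∈ N ∧ v₄ ∈ N ∧
      p v₁ ∈ A ∧ p v₂ ∈ A ∧ p v₃ ∈ B ∧ p v₄ ∈ B

lemma hasSplit_of_tripod_hit {N : Set U} {p : U → V} {w₁ w₂ w₃ w₄ : U}
    (hw : [w₁, w₂, w₃, w₄].Nodup) (h1 : w₁ ∈ N) (h2 : w₂ ∈ N) (h3 : w₃ ∈ N) (h4 : w₄ ∈ N)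
    {c : V} {L₁ L₂ L₃ : List V} (hn : (c :: (L₁ ++ (L₂ ++ L₃))).Nodup)
    (hmem : ∀ w ∈ c :: (L₁ ++ (L₂ ++ L₃)), w ∈ S)
    (c₁ : (c :: L₁).IsChain G.Adj) (c₂ : (c :: L₂).IsChain G.Adj) (c₃ : (c :: L₃).IsChain G.Adj)
    (k₁ : (c :: L₁).getLast? = some (p w₁)) (k₂ : p w₂ ∈ c :: L₂) (k₃ : p w₃ ∈ c :: L₃)
    {t : V} {m : List V} (ht : t ∈ L₁) (cm : (t :: m).IsChain G.Adj) (hmS : ∀ x ∈ t :: m, x ∈ S)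
    (km : p w₄ ∈ t :: m) (hm : ∀ x ∈ m, x ∉ c :: (L₁ ++ (L₂ ++ L₃))) : HasSplit G S N p := by
  obtain ⟨A, B, rfl⟩ := List.append_of_mem ht
  have e : c :: (A ++ t :: B) = (c :: A) ++ (t :: B) := by simp
  rw [e] at c₁ k₁
  obtain ⟨d₁, d₂, d₃⟩ := List.isChain_append.1 c₁
  have k₁' : p w₁ ∈ t :: B := by
    rw [List.getLast?_append_cons] at k₁
    exact List.mem_of_getLast? k₁
  refine ⟨{v | v ∈ t :: B} ∪ {v | v ∈ t :: m},
    ({v | v ∈ c :: A} ∪ {v | v ∈ c :: L₂}) ∪ {v | v ∈ c :: L₃}, ?_, ?_, ?_,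
    (SetConn.of_isChain d₂).union_inter (SetConn.of_isChain cm) (x := t) (by simp) (by simp),
    ((SetConn.of_isChain d₁).union_inter (SetConn.of_isChain c₂) (x := c)
      (by simp) (by simp)).union_inter (SetConn.of_isChain c₃) (x := c) (by simp) (by simp), ?_,
    w₁, w₄, w₂, w₃, by grind, h1, h4, h2, h3, Or.inl k₁', Or.inr km,
    Or.inl (Or.inr k₂), Or.inr k₃⟩
  · intro v hv
    simp only [Set.mem_union, Set.mem_ofPred_eq, List.mem_cons, List.mem_append] at *
    grind
  · intro v hv
    simp only [Set.mem_union, Set.mem_ofPred_eq, List.mem_cons, List.mem_append] at *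
    grind
  · rw [Set.disjoint_left]
    intro v hv hv'
    simp only [Set.mem_union, Set.mem_ofPred_eq, List.mem_cons, List.mem_append, List.nodup_cons,
      List.nodup_append] at *
    grind
  · obtain ⟨z, hz⟩ : ∃ z, (c :: A).getLast? = some z := by
      rcases h : (c :: A).getLast? with _ | b
      · simp at h
      · exact ⟨b, rfl⟩
    exact ⟨t, Or.inl (by simp), z, Or.inl (Or.inl (List.mem_of_getLast? hz)),
      (d₃ z hz t (by simp)).symm⟩

end Star

section Minor

variable {V U : Type*} {G : SimpleGraph V} {S : Set V}

lemma SetConn.star_or_split (hS : SetConn G S) {N : Set U} {p : U → V} {w₁ w₂ w₃ w₄ : U}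
    (hw : [w₁, w₂, w₃, w₄].Nodup) (hN : ∀ w, w ∈ N ↔ w = w₁ ∨ w = w₂ ∨ w = w₃ ∨ w = w₄)
    (hp : ∀ w ∈ N, p w ∈ S) : (∃ c Q, IsStarAt G S N p c Q) ∨ HasSplit G S N p := by
  classical
  have m₁ : w₁ ∈ N := (hN _).2 (by simp)
  have m₂ : w₂ ∈ N := (hN _).2 (by simp)
  have m₃ : w₃ ∈ N := (hN _).2 (by simp)
  have m₄ : w₄ ∈ N := (hN _).2 (by simp)
  obtain ⟨c, L₁, L₂, L₃, hn, hmem, h₁, h₂, h₃, k₁, k₂, k₃⟩ :=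
    hS.exists_tripod (hp w₁ m₁) (hp w₂ m₂) (hp w₃ m₃)
  obtain ⟨t, ht, m, hmc, hmn, hmS, hmlast, hmT⟩ :=
    hS.exists_firstHit (T := {v | v ∈ c :: (L₁ ++ (L₂ ++ L₃))}) hmem ⟨c, by simp⟩ (hp w₄ m₄)
  have e₁ := List.mem_of_getLast? k₁
  have e₂ := List.mem_of_getLast? k₂
  have e₃ := List.mem_of_getLast? k₃
  have e₄ := List.mem_of_getLast? hmlast
  simp only [Set.mem_ofPred_eq] at ht hmT
  rcases List.mem_cons.1 ht with rfl | ht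
  · left
    refine ⟨t, fun w => {v | v ∈ t :: (if w = w₁ then L₁ else if w = w₂ then L₂ else
      if w = w₃ then L₃ else m)}, hmem t (by simp),
      fun w hw => ⟨?_, by simp, ?_, SetConn.of_isChain ?_⟩, ?_⟩
    · intro v hv
      simp only [Set.mem_ofPred_eq, List.mem_cons, List.mem_append] at hv hmem hmS
      grind
    · simp only [Set.mem_ofPred_eq]
      rcases (hN w).1 hw with rfl | rfl | rfl | rfl <;> grind
    · rcases (hN w).1 hw with rfl | rfl | rfl | rfl <;> grind
    · intro w hw w' hw' hne x hx hx'
      simp only [Set.mem_ofPred_eq, List.mem_cons, List.nodup_cons, List.nodup_append,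
        List.mem_append] at hx hx' hn hmT
      clear hmem h₁ h₂ h₃ k₁ k₂ k₃ e₁ e₂ e₃ e₄ hmc hmS hmlast hp m₁ m₂ m₃ m₄
      rcases (hN w).1 hw with rfl | rfl | rfl | rfl <;>
        rcases (hN w').1 hw' with rfl | rfl | rfl | rfl <;> grind
  · right
    rcases List.mem_append.1 ht with ht | ht
    · exact hasSplit_of_tripod_hit hw m₁ m₂ m₃ m₄ hn hmem h₁ h₂ h₃ k₁ e₂ e₃ ht hmc hmS e₄ hmT
    rcases List.mem_append.1 ht with ht | ht
    · have hperm : (c :: (L₂ ++ (L₁ ++ L₃))).Perm (c :: (L₁ ++ (L₂ ++ L₃))) := by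
        simpa using List.perm_append_comm_assoc L₂ L₁ L₃
      exact hasSplit_of_tripod_hit (by grind : [w₂, w₁, w₃, w₄].Nodup) m₂ m₁ m₃ m₄
        (hperm.nodup_iff.2 hn) (fun w h => hmem w (hperm.mem_iff.1 h)) h₂ h₁ h₃ k₂ e₁ e₃ ht hmc
        hmS e₄ (fun x hx h => hmT x hx (hperm.mem_iff.1 h))
    · have hperm : (c :: (L₃ ++ (L₁ ++ L₂))).Perm (c :: (L₁ ++ (L₂ ++ L₃))) := by
        rw [List.perm_cons, ← List.append_assoc L₁]
        exact List.perm_append_comm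
      exact hasSplit_of_tripod_hit (by grind : [w₃, w₁, w₂, w₄].Nodup) m₃ m₁ m₂ m₄
        (hperm.nodup_iff.2 hn) (fun w h => hmem w (hperm.mem_iff.1 h)) h₃ h₁ h₂ k₃ e₁ e₂ ht hmc
        hmS e₄ (fun x hx h => hmT x hx (hperm.mem_iff.1 h))

lemma containsSubdivision_of_isStarAt {H : SimpleGraph U} {S : U → Set V}
    (hdisj : ∀ u w, u ≠ w → Disjoint (S u) (S w)) {p : U → U → V}
    (hadj : ∀ u w, H.Adj u w → G.Adj (p u w) (p w u)) {c : U → V} {Q : U → U → Set V}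
    (h : ∀ u, IsStarAt G (S u) {w | H.Adj u w} (p u) (c u) (Q u)) :
    ContainsSubdivision G H := by
  have key : ∀ u w, ∀ x ∈ S u, x ∈ S w → u = w := fun u w x hu hw => by
    by_contra hne
    exact Set.disjoint_left.1 (hdisj u w hne) hu hw
  have hP : ∀ u w, H.Adj u w → ∃ P : G.Walk (c u) (c w), P.IsPath ∧
      ∀ z ∈ P.support, z ∈ Q u w ∪ Q w u := fun u w huw => by
    obtain ⟨-, h1, h2, h3⟩ := (h u).2.1 w huw
    obtain ⟨-, h4, h5, h6⟩ := (h w).2.1 u huw.symm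
    exact (h3.union_adj h6 h2 h5 (hadj u w huw)).exists_walk (Or.inl h1) (Or.inr h4)
  choose P hP hPs using hP
  refine ⟨c, fun u w huw => key u w _ (h u).1 (huw ▸ (h w).1), fun u w h => P u w h,
    fun u w h => hP u w h, ?_, ?_⟩
  · rintro u w huw x hx ⟨v, rfl⟩
    rcases hPs u w huw _ hx with hx | hx
    · left; rw [key u v _ (((h u).2.1 w huw).1 hx) (h v).1]
    · right; rw [key w v _ (((h w).2.1 u huw.symm).1 hx) (h v).1]
  · have aux : ∀ u w, H.Adj u w → ∀ u' w', H.Adj u' w' → s(u, w) ≠ s(u', w') → ∀ x ∈ Q u w,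
        x ∈ Q u' w' → x ∈ Set.range c := by
      intro u w huw u' w' huw' hne x hx hx'
      have : u = u' := key u u' x (((h u).2.1 w huw).1 hx) (((h u').2.1 w' huw').1 hx')
      subst this
      exact ⟨u, ((h u).2.2 w huw w' huw' (fun e => hne (e ▸ rfl)) x hx hx').symm⟩
    intro u w huw u' w' huw' hne x hx hx'
    rcases hPs u w huw _ hx with hx | hx <;> rcases hPs u' w' huw' _ hx' with hx' | hx'
    · exact aux u w huw u' w' huw' hne x hx hx'
    · exact aux u w huw w' u' huw'.symm (by rwa [Sym2.eq_swap (a := w')]) x hx hx'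
    · exact aux w u huw.symm u' w' huw' (by rwa [Sym2.eq_swap (a := w)]) x hx hx'
    · exact aux w u huw.symm w' u' huw'.symm
        (by rwa [Sym2.eq_swap (a := w), Sym2.eq_swap (a := w')]) x hx hx'

/-- `H` is a minor of `G`, witnessed by disjoint connected branch sets. -/
def HasMinor (G : SimpleGraph V) (H : SimpleGraph U) : Prop :=
  ∃ S : U → Set V, (∀ u, SetConn G (S u)) ∧ (∀ u w, u ≠ w → Disjoint (S u) (S w)) ∧
    ∀ u w, H.Adj u w → ∃ x ∈ S u, ∃ y ∈ S w, G.Adj x y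

lemma exists_portals [hV : Nonempty V] {H : SimpleGraph U} {S : U → Set V}
    (h : ∀ u w, H.Adj u w → ∃ x ∈ S u, ∃ y ∈ S w, G.Adj x y) :
    ∃ p : U → U → V, ∀ u w, H.Adj u w → p u w ∈ S u ∧ G.Adj (p u w) (p w u) := by
  classical
  have h' : ∀ u w, ∃ x y, H.Adj u w → x ∈ S u ∧ y ∈ S w ∧ G.Adj x y := fun u w => by
    by_cases huw : H.Adj u w
    · obtain ⟨x, hx, y, hy, hxy⟩ := h u w huw
      exact ⟨x, y, fun _ => ⟨hx, hy, hxy⟩⟩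
    · obtain ⟨x⟩ := hV
      exact ⟨x, x, fun h => (huw h).elim⟩
  choose x y hxy using h'
  refine ⟨fun u w => if WellOrderingRel u w then x u w else y w u, fun u w huw => ?_⟩
  have a := hxy u w huw
  have b := hxy w u huw.symm
  rcases trichotomous_of (WellOrderingRel) u w with hr | hr | hr
  · have hr' : ¬ WellOrderingRel w u := fun h => asymm_of WellOrderingRel hr h
    simp only [hr, hr', if_true, if_false]
    exact ⟨a.1, a.2.2⟩
  · exact (huw.ne hr).elim
  · have hr' : ¬ WellOrderingRel u w := fun h => asymm_of WellOrderingRel hr h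
    simp only [hr, hr', if_true, if_false]
    exact ⟨b.2.1, b.2.2.symm⟩

lemma HasMinor.containsSubdivision_K33
    (h : HasMinor G (completeBipartiteGraph (Fin 3) (Fin 3))) :
    ContainsSubdivision G (completeBipartiteGraph (Fin 3) (Fin 3)) := by
  obtain ⟨S, hS, hd, ha⟩ := h
  have : Nonempty V := ⟨(hS (.inl 0)).1.choose⟩
  obtain ⟨p, hp⟩ := exists_portals ha
  have : ∀ u, ∃ c Q, IsStarAt G (S u) {w | (completeBipartiteGraph (Fin 3) (Fin 3)).Adj u w}
      (p u) c Q := by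
    rintro (i | i)
    · refine (hS _).exists_isStarAt_three (w₁ := .inr 0) (w₂ := .inr 1) (w₃ := .inr 2) ?_ ?_
      · rintro (j | j)
        · simp
        · fin_cases j <;> simp
      · rintro w hw
        refine (hp _ _ ?_).1
        rcases hw with rfl | rfl | rfl <;> simp
    · refine (hS _).exists_isStarAt_three (w₁ := .inl 0) (w₂ := .inl 1) (w₃ := .inl 2) ?_ ?_
      · rintro (j | j)
        · fin_cases j <;> simp
        · simp
      · rintro w hw
        refine (hp _ _ ?_).1
        rcases hw with rfl | rfl | rfl <;> simp
  choose c Q hQ using this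
  exact containsSubdivision_of_isStarAt hd (fun u w h => (hp u w h).2) hQ

lemma hasMinor_K33 {A₁ A₂ A₃ B₁ B₂ B₃ : Set V} (hd : [A₁, A₂, A₃, B₁, B₂, B₃].Pairwise Disjoint)
    (hc : ∀ S ∈ [A₁, A₂, A₃, B₁, B₂, B₃], SetConn G S)
    (ha : ∀ S ∈ [A₁, A₂, A₃], ∀ T ∈ [B₁, B₂, B₃], ∃ x ∈ S, ∃ y ∈ T, G.Adj x y) :
    HasMinor G (completeBipartiteGraph (Fin 3) (Fin 3)) := by
  simp only [List.pairwise_cons, List.mem_cons, List.not_mem_nil, or_false, forall_eq_or_imp,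
    forall_eq] at hd hc ha
  refine ⟨Sum.elim ![A₁, A₂, A₃] ![B₁, B₂, B₃], ?_, ?_, ?_⟩
  · rintro (i | i) <;> fin_cases i <;> simp [hc]
  · rintro (i | i) (j | j) <;> fin_cases i <;> fin_cases j <;> simp [hd, disjoint_comm]
  · have hs : ∀ A B : Set V, (∃ x ∈ A, ∃ y ∈ B, G.Adj x y) → ∃ x ∈ B, ∃ y ∈ A, G.Adj x y := by
      rintro A B ⟨x, hx, y, hy, h⟩
      exact ⟨y, hy, x, hx, h.symm⟩
    rintro (i | i) (j | j) h
    · simp at h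
    · fin_cases i <;> fin_cases j <;> simp [ha]
    · apply hs
      fin_cases i <;> fin_cases j <;> simp [ha]
    · simp at h

lemma HasMinor.containsSubdivision_K5 (h : HasMinor G (completeGraph (Fin 5))) :
    ContainsSubdivision G (completeGraph (Fin 5)) ∨
      ContainsSubdivision G (completeBipartiteGraph (Fin 3) (Fin 3)) := by
  obtain ⟨S, hS, hd, ha⟩ := h
  have : Nonempty V := ⟨(hS 0).1.choose⟩
  obtain ⟨p, hp⟩ := exists_portals ha
  by_cases hsp : ∃ u, HasSplit G (S u) {w | (completeGraph (Fin 5)).Adj u w} (p u)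
  · right
    apply HasMinor.containsSubdivision_K33
    obtain ⟨u, A, B, hA, hB, hAB, hcA, hcB, hadj, v₁, v₂, v₃, v₄, hv, m₁, m₂, m₃, m₄,
      k₁, k₂, k₃, k₄⟩ := hsp
    simp only [Set.mem_ofPred_eq, completeGraph_eq_top, top_adj] at m₁ m₂ m₃ m₄
    simp only [completeGraph_eq_top, top_adj] at ha hp
    simp only [List.nodup_cons, List.mem_cons, List.not_mem_nil, or_false, not_or] at hv
    obtain ⟨⟨n₁, n₂, n₃⟩, ⟨n₄, n₅⟩, n₆, -⟩ := hv
    refine hasMinor_K33 (A₁ := A) (A₂ := S v₃) (A₃ := S v₄) (B₁ := B) (B₂ := S v₁) (B₃ := S v₂)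
      ?_ ?_ ?_
    · have hAS : ∀ v, u ≠ v → Disjoint A (S v) := fun v h => (hd u v h).mono_left hA
      have hBS : ∀ v, u ≠ v → Disjoint B (S v) := fun v h => (hd u v h).mono_left hB
      simp only [List.pairwise_cons, List.mem_cons, List.not_mem_nil, or_false, forall_eq_or_imp,
        forall_eq]
      refine ⟨⟨hAS _ m₃, hAS _ m₄, hAB, hAS _ m₁, hAS _ m₂⟩,
        ⟨hd _ _ n₆, (hBS _ m₃).symm, hd _ _ (Ne.symm n₂), hd _ _ (Ne.symm n₄)⟩,
        ⟨(hBS _ m₄).symm, hd _ _ (Ne.symm n₃), hd _ _ (Ne.symm n₅)⟩, ⟨hBS _ m₁, hBS _ m₂⟩,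
        hd _ _ n₁, by simp⟩
    · simp [hcA, hcB, hS]
    · simp only [List.mem_cons, List.not_mem_nil, or_false, forall_eq_or_imp, forall_eq]
      refine ⟨⟨hadj, ⟨_, k₁, _, (hp v₁ u m₁.symm).1, (hp u v₁ m₁).2⟩,
        ⟨_, k₂, _, (hp v₂ u m₂.symm).1, (hp u v₂ m₂).2⟩⟩,
        ⟨⟨_, (hp v₃ u m₃.symm).1, _, k₃, (hp v₃ u m₃.symm).2⟩, ha _ _ (Ne.symm n₂),
          ha _ _ (Ne.symm n₄)⟩,
        ⟨_, (hp v₄ u m₄.symm).1, _, k₄, (hp v₄ u m₄.symm).2⟩, ha _ _ (Ne.symm n₃),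
          ha _ _ (Ne.symm n₅)⟩
  · left
    have : ∀ u, ∃ c Q, IsStarAt G (S u) {w | (completeGraph (Fin 5)).Adj u w} (p u) c Q := by
      intro u
      refine ((hS u).star_or_split (w₁ := u + 1) (w₂ := u + 2) (w₃ := u + 3) (w₄ := u + 4)
        ?_ ?_ ?_).resolve_right (fun h => hsp ⟨u, h⟩)
      · revert u; decide
      · simp only [Set.mem_ofPred_eq, completeGraph_eq_top, top_adj]
        revert u; decide
      · exact fun w hw => (hp u w hw).1
    choose c Q hQ using this
    exact containsSubdivision_of_isStarAt hd (fun u w h => (hp u w h).2) hQ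

lemma hasMinor_K5 {A : Fin 5 → Set V} (hd : ∀ i j, i < j → Disjoint (A i) (A j))
    (hc : ∀ i, SetConn G (A i)) (ha : ∀ i j, i < j → ∃ x ∈ A i, ∃ y ∈ A j, G.Adj x y) :
    HasMinor G (completeGraph (Fin 5)) := by
  refine ⟨A, hc, fun i j h => ?_, fun i j h => ?_⟩
  · rcases lt_or_gt_of_ne h with h | h
    · exact hd i j h
    · exact (hd j i h).symm
  · rcases lt_or_gt_of_ne h.ne with h | h
    · exact ha i j h
    · obtain ⟨x, hx, y, hy, hxy⟩ := ha j i h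
      exact ⟨y, hy, x, hx, hxy.symm⟩

end Minor

section Lists

variable {α : Type*}

lemma List.exists_eq_append_first {l : List α} {P : α → Prop} (h : ∃ x ∈ l, P x) :
    ∃ A x B, l = A ++ x :: B ∧ P x ∧ ∀ a ∈ A, ¬ P a := by
  induction l with
  | nil => simp at h
  | cons y l ih =>
    by_cases hy : P y
    · exact ⟨[], y, l, rfl, hy, by simp⟩
    · obtain ⟨x, hx, hPx⟩ := h
      rcases List.mem_cons.1 hx with rfl | hx
      · exact (hy hPx).elim
      obtain ⟨A, x, B, rfl, h1, h2⟩ := ih ⟨x, hx, hPx⟩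
      exact ⟨y :: A, x, B, rfl, h1, by simpa using ⟨hy, h2⟩⟩

lemma List.exists_eq_append_last {l : List α} {P : α → Prop} (h : ∃ x ∈ l, P x) :
    ∃ A x B, l = A ++ x :: B ∧ P x ∧ ∀ b ∈ B, ¬ P b := by
  obtain ⟨A, x, B, h1, h2, h3⟩ := List.exists_eq_append_first (l := l.reverse) (P := P)
    (by simpa using h)
  refine ⟨B.reverse, x, A.reverse, ?_, h2, by simpa using h3⟩
  rw [← List.reverse_reverse l, h1]
  simp

lemma List.isRotated_append_cons (A : List α) (x : α) (B : List α) :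
    A ++ x :: B ~r x :: (B ++ A) := by
  simpa using List.isRotated_append (l := A) (l' := x :: B)

lemma List.IsRotated.of_append {C : List α} (A : List α) (x : α) (B : List α)
    (h : C ~r A ++ x :: B) : C ~r x :: (B ++ A) :=
  h.trans (List.isRotated_append_cons A x B)

/-- How two sets of vertices may be placed around a cycle: either some `M`-segment can be replaced,
or `M` and `N` alternate, or they share three vertices. -/
lemma List.cyclic_trichotomy {C : List α} {M N : α → Prop}
    (hM : ∃ x ∈ C, ∃ y ∈ C, x ≠ y ∧ M x ∧ M y) :
    (∃ c S₁ c' S₂, C ~r c :: (S₁ ++ c' :: S₂) ∧ M c ∧ M c' ∧ (∀ x ∈ S₂, ¬ M x) ∧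
      ∀ x ∈ S₁, ¬ N x) ∨
    (∃ c A₁ s A₂ c' A₃ s' A₄, C ~r c :: (A₁ ++ s :: (A₂ ++ c' :: (A₃ ++ s' :: A₄))) ∧
      M c ∧ M c' ∧ N s ∧ N s') ∨
    (∃ c₁ A₁ c₂ A₂ c₃ A₃, C ~r c₁ :: (A₁ ++ c₂ :: (A₂ ++ c₃ :: A₃)) ∧
      M c₁ ∧ M c₂ ∧ M c₃ ∧ N c₁ ∧ N c₂ ∧ N c₃) := by
  obtain ⟨x₀, hx₀, y₀, hy₀, hne, hMx₀, hMy₀⟩ := hM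
  have rot : ∀ x ∈ C, ∃ R, C ~r x :: R := fun x hx => by
    obtain ⟨A, B, rfl⟩ := List.append_of_mem hx
    exact ⟨_, List.isRotated_append_cons A x B⟩
  by_cases h₁ : ∃ s ∈ C, N s ∧ ¬ M s
  · obtain ⟨s, hs, hNs, hMs⟩ := h₁
    obtain ⟨R, hR⟩ := rot s hs
    have hx₀' : x₀ ∈ s :: R := hR.mem_iff.1 hx₀
    have hy₀' : y₀ ∈ s :: R := hR.mem_iff.1 hy₀
    obtain ⟨R₁, x, R', rfl, hMx, hR₁⟩ := List.exists_eq_append_first (l := R) (P := M)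
      (by grind)
    obtain ⟨R₃, y, R₄, rfl, hMy, hR₄⟩ := List.exists_eq_append_last (l := R') (P := M)
      (by grind)
    have hR' : C ~r x :: (R₃ ++ y :: (R₄ ++ s :: R₁)) := by
      have := List.IsRotated.of_append (s :: R₁) x (R₃ ++ y :: R₄) (by simpa using hR)
      simpa using this
    by_cases hn : ∃ n ∈ R₃, N n
    · obtain ⟨n, hn, hNn⟩ := hn
      obtain ⟨P, Q, rfl⟩ := List.append_of_mem hn
      exact Or.inr (Or.inl ⟨x, P, n, Q, y, R₄, s, R₁, by simpa using hR', hMx, hMy, hNn, hNs⟩)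
    · exact Or.inl ⟨x, R₃, y, R₄ ++ s :: R₁, hR', hMx, hMy, by grind, by grind⟩
  push Not at h₁
  by_cases h₂ : ∃ x ∈ C, N x
  swap
  · obtain ⟨R, hR⟩ := rot x₀ hx₀
    have hy₀' : y₀ ∈ x₀ :: R := hR.mem_iff.1 hy₀
    obtain ⟨R₁, y, R₂, rfl, hMy, hR₂⟩ := List.exists_eq_append_last (l := R) (P := M) (by grind)
    refine Or.inl ⟨x₀, R₁, y, R₂, hR, hMx₀, hMy, hR₂, fun x hx hNx => h₂ ⟨x, ?_, hNx⟩⟩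
    exact hR.mem_iff.2 (by simp [hx])
  obtain ⟨x, hx, hNx⟩ := h₂
  have hMx := h₁ x hx hNx
  obtain ⟨R, hR⟩ := rot x hx
  have hx₀' : x₀ ∈ x :: R := hR.mem_iff.1 hx₀
  have hy₀' : y₀ ∈ x :: R := hR.mem_iff.1 hy₀
  have hNM : ∀ z ∈ R, N z → M z := fun z hz => h₁ z (hR.mem_iff.2 (by simp [hz]))
  obtain ⟨R₁, y₁, R₂, rfl, hMy₁, hR₁⟩ := List.exists_eq_append_first (l := R) (P := M) (by grind)
  by_cases hn : ∃ n ∈ R₂, N n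
  swap
  · refine Or.inl ⟨y₁, R₂, x, R₁, ?_, hMy₁, hMx, hR₁, by grind⟩
    simpa using List.IsRotated.of_append (x :: R₁) y₁ R₂ (by simpa using hR)
  obtain ⟨n, hn, hNn⟩ := hn
  obtain ⟨R₃, y₂, R₄, rfl, hMy₂, hR₄⟩ := List.exists_eq_append_last (l := R₂) (P := M) (by grind)
  by_cases h₃ : ∃ n' ∈ R₃, N n'
  · obtain ⟨n', hn', hNn'⟩ := h₃
    obtain ⟨P, Q, rfl⟩ := List.append_of_mem hn'
    refine Or.inr (Or.inl ⟨y₁, P, n', Q, y₂, R₄, x, R₁, ?_, hMy₁, hMy₂, hNn', hNx⟩)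
    have := List.IsRotated.of_append (x :: R₁) y₁ (P ++ n' :: (Q ++ y₂ :: R₄))
      (by simpa using hR)
    simpa using this
  by_cases h₄ : N y₁
  · refine Or.inr (Or.inr ⟨x, R₁, y₁, R₃, y₂, R₄, hR, hMx, hMy₁, hMy₂, hNx, h₄, ?_⟩)
    have : n = y₂ := by grind
    exact this ▸ hNn
  · exact Or.inl ⟨x, R₁ ++ y₁ :: R₃, y₂, R₄, by simpa using hR, hMx, hMy₂, hR₄, by grind⟩

end Lists

section Ear

variable {V : Type*} {K : SimpleGraph V} {O H : Finset V} {E : List V} {c c' : V}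

/-- `E` is a path in `O \ H` with ends attached to distinct vertices `c`, `c'` outside `O`,
and `H ⊆ O` is empty or connected. -/
structure IsEar (K : SimpleGraph V) (O H : Finset V) (E : List V) (c c' : V) : Prop where
  nodup : E.Nodup
  chain : E.IsChain K.Adj
  mem : ∀ x ∈ E, x ∈ O ∧ x ∉ H
  sub : H ⊆ O
  conn : H = ∅ ∨ SetConn K (H : Set V)
  left_notMem : c ∉ O
  right_notMem : c' ∉ O
  ne : c ≠ c'
  head : ∃ x, E.head? = some x ∧ K.Adj x c
  last : ∃ x, E.getLast? = some x ∧ K.Adj x c'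

lemma IsEar.ne_nil (h : IsEar K O H E c c') : E ≠ [] := by
  rintro rfl
  simpa using h.head

lemma SetConn.exists_isEar {F : Set V} (hF : SetConn K F) (hFO : ∀ x ∈ F, x ∈ O ∧ x ∉ H)
    (hHO : H ⊆ O) (hH : H = ∅ ∨ SetConn K (H : Set V)) (hc : c ∉ O) (hc' : c' ∉ O)
    (hne : c ≠ c') (h : ∃ x ∈ F, K.Adj x c) (h' : ∃ x ∈ F, K.Adj x c') :
    ∃ E, IsEar K O H E c c' ∧ ∀ x ∈ E, x ∈ F := by
  obtain ⟨x, hx, hxc⟩ := h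
  obtain ⟨y, hy, hyc⟩ := h'
  obtain ⟨l, h1, h2, h3, h4⟩ := hF.exists_path hx hy
  exact ⟨x :: l, ⟨h2, h1, fun z hz => hFO z (h3 z hz), hHO, hH, hc, hc', hne, ⟨x, rfl, hxc⟩,
    ⟨y, h4, hyc⟩⟩, h3⟩

lemma SetConn.exists_boundary_adj {S T : Set V} (hS : SetConn K S) {x y : V} (hx : x ∈ S)
    (hxT : x ∈ T) (hy : y ∈ S) (hyT : y ∉ T) : ∃ u ∈ S, ∃ v ∈ S, u ∈ T ∧ v ∉ T ∧ K.Adj u v := by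
  have h := hS.2 x hx y hy
  induction h with
  | refl => exact (hyT hxT).elim
  | @tail b d _ h ih =>
    by_cases hb : b ∈ T
    · exact ⟨b, h.2.1, d, h.2.2, hb, hyT, h.1⟩
    · exact ih h.2.1 hb

lemma IsEar.shortcut {P R Q : List V} {u v : V}
    (h : IsEar K O H (P ++ u :: (Q ++ v :: R)) c c') (huv : K.Adj u v) :
    IsEar K O H (P ++ u :: v :: R) c c' := by
  refine ⟨?_, ?_, fun x hx => h.mem x ?_, h.sub, h.conn, h.left_notMem, h.right_notMem, h.ne,
    ?_, ?_⟩
  · have := h.nodup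
    simp only [List.nodup_append, List.nodup_cons, List.mem_append, List.mem_cons] at this ⊢
    grind
  · obtain ⟨h1, h2⟩ := List.isChain_split.1 h.chain
    have e : u :: (Q ++ v :: R) = (u :: Q) ++ v :: R := by simp
    rw [e] at h2
    exact List.isChain_split.2 ⟨h1, List.isChain_cons_cons.2 ⟨huv, (List.isChain_split.1 h2).2⟩⟩
  · simp only [List.mem_append, List.mem_cons] at hx ⊢
    grind
  · obtain ⟨x, hx, h'⟩ := h.head
    refine ⟨x, ?_, h'⟩
    rcases P with _ | ⟨p, P⟩ <;> simpa using hx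
  · obtain ⟨x, hx, h'⟩ := h.last
    refine ⟨x, ?_, h'⟩
    have e : P ++ u :: (Q ++ v :: R) = (P ++ u :: Q) ++ v :: R := by simp
    have e' : P ++ u :: v :: R = (P ++ [u]) ++ v :: R := by simp
    rw [e, List.getLast?_append_cons] at hx
    rwa [e', List.getLast?_append_cons]

lemma IsEar.truncate_right {P R : List V} {v d : V} (h : IsEar K O H (P ++ v :: R) c c')
    (hvd : K.Adj v d) (hd : d ∉ O) (hdc : d ≠ c) : IsEar K O H (P ++ [v]) c d := by
  refine ⟨?_, (List.isChain_split.1 h.chain).1, fun x hx => h.mem x ?_, h.sub, h.conn,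
    h.left_notMem, hd, hdc.symm, ?_, ⟨v, by simp, hvd⟩⟩
  · have := h.nodup
    simp only [List.nodup_append, List.nodup_cons, List.mem_cons, List.not_mem_nil] at this ⊢
    grind
  · simp only [List.mem_append, List.mem_cons, List.not_mem_nil] at hx ⊢
    grind
  · obtain ⟨x, hx, h'⟩ := h.head
    refine ⟨x, ?_, h'⟩
    rcases P with _ | ⟨p, P⟩ <;> simpa using hx

lemma IsEar.truncate_left {P R : List V} {v d : V} (h : IsEar K O H (P ++ v :: R) c c')
    (hvd : K.Adj v d) (hd : d ∉ O) (hdc : d ≠ c') : IsEar K O H (v :: R) d c' := by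
  refine ⟨(List.nodup_append.1 h.nodup).2.1, (List.isChain_split.1 h.chain).2,
    fun x hx => h.mem x (List.mem_append_right _ hx), h.sub, h.conn,
    hd, h.right_notMem, hdc, ⟨v, rfl, hvd⟩, ?_⟩
  obtain ⟨x, hx, h'⟩ := h.last
  exact ⟨x, by rwa [List.getLast?_append_cons] at hx, h'⟩

/-- A nonseparating ear whose inner structure is as simple as possible. -/
structure IsGoodEar (K : SimpleGraph V) (O H : Finset V) (E : List V) (c c' : V) : Prop
    extends IsEar K O H E c c' where
  cover : ∀ x ∈ O, x ∈ H ∨ x ∈ E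
  simple : (∃ v, E = [v]) ∨
    (∀ x ∈ E, ∃ u w, ∀ y, K.Adj x y → y ∈ E ∨ y ∉ O → y = u ∨ y = w) ∧
    ∀ x ∈ E, ∀ y, y ∉ O → K.Adj x y →
      (y = c ∧ E.head? = some x) ∨ (y = c' ∧ E.getLast? = some x)

lemma IsEar.simple_of_minimal (h : IsEar K O H E c c')
    (hmin : ∀ E' d d', IsEar K O H E' d d' → E.length ≤ E'.length) :
    (∃ v, E = [v]) ∨
    (∀ x ∈ E, ∃ u w, ∀ y, K.Adj x y → y ∈ E ∨ y ∉ O → y = u ∨ y = w) ∧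
    ∀ x ∈ E, ∀ y, y ∉ O → K.Adj x y →
      (y = c ∧ E.head? = some x) ∨ (y = c' ∧ E.getLast? = some x) := by
  by_cases hs : ∃ v, E = [v]
  · exact Or.inl hs
  right
  have key : ∀ P v R, E = P ++ v :: R → ∀ y, y ∉ O → K.Adj v y →
      (y = c ∧ P = [] ∧ R ≠ []) ∨ (y = c' ∧ R = [] ∧ P ≠ []) := by
    rintro P v R rfl y hy hvy
    have h1 : y = c ∨ R = [] := by
      by_contra! hc
      have h2 := hmin _ _ _ (h.truncate_right hvy hy hc.1)
      have := List.length_pos_of_ne_nil hc.2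
      simp only [List.length_append, List.length_cons, List.length_nil] at h2
      omega
    have h2 : y = c' ∨ P = [] := by
      by_contra! hc
      have h2 := hmin _ _ _ (h.truncate_left hvy hy hc.1)
      have := List.length_pos_of_ne_nil hc.2
      simp only [List.length_append, List.length_cons] at h2
      omega
    have h3 : ¬ (P = [] ∧ R = []) := by
      rintro ⟨rfl, rfl⟩
      exact hs ⟨v, rfl⟩
    have := h.ne
    grind
  refine ⟨fun x hx => ?_, fun x hx y hy hxy => ?_⟩
  · obtain ⟨P, R, hPR⟩ := List.append_of_mem hx
    refine ⟨P.getLastD c, R.headD c', fun y hxy hy => ?_⟩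
    by_cases hyE : y ∈ E
    · rw [hPR, List.mem_append, List.mem_cons] at hyE
      rcases hyE with hyP | rfl | hyR
      · left
        obtain ⟨P₁, P₂, rfl⟩ := List.append_of_mem hyP
        have e : P₁ ++ y :: P₂ ++ x :: R = P₁ ++ y :: (P₂ ++ x :: R) := by simp
        rw [e] at hPR
        subst hPR
        have := hmin _ _ _ (h.shortcut hxy.symm)
        simp only [List.length_append, List.length_cons] at this
        have : P₂ = [] := List.length_eq_zero_iff.1 (by omega)
        subst this
        simp
      · exact (K.irrefl hxy).elim
      · right
        obtain ⟨P₁, P₂, rfl⟩ := List.append_of_mem hyR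
        subst hPR
        have := hmin _ _ _ (h.shortcut hxy)
        simp only [List.length_append, List.length_cons] at this
        have : P₁ = [] := List.length_eq_zero_iff.1 (by omega)
        subst this
        simp
    · rcases key P x R hPR y (hy.resolve_left hyE) hxy with ⟨rfl, rfl, -⟩ | ⟨rfl, rfl, -⟩
      · left; simp
      · right; simp
  · obtain ⟨P, R, hPR⟩ := List.append_of_mem hx
    rcases key P x R hPR y hy hxy with ⟨rfl, rfl, -⟩ | ⟨rfl, rfl, -⟩
    · left; simp [hPR]
    · right; simp [hPR]

lemma List.exists_eq_append_first_last {l : List V} {P : V → Prop} {x y : V} (hx : x ∈ l)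
    (hy : y ∈ l) (hxy : x ≠ y) (hPx : P x) (hPy : P y) :
    ∃ A s B s' C, l = A ++ s :: (B ++ s' :: C) ∧ P s ∧ P s' ∧ (∀ a ∈ A, ¬ P a) ∧
      ∀ a ∈ C, ¬ P a := by
  obtain ⟨A, s, R, rfl, hs, hA⟩ := List.exists_eq_append_first ⟨x, hx, hPx⟩
  have : ∃ z ∈ R, P z := by grind
  obtain ⟨B, s', C, rfl, hs', hC⟩ := List.exists_eq_append_last this
  exact ⟨A, s, B, s', C, rfl, hs, hs', hA, hC⟩

lemma List.Nodup.split_two {P Q R : List V} {s s' : V} (h : (P ++ s :: (Q ++ s' :: R)).Nodup) :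
    s' ∉ P ++ [s] ∧ s ∉ s' :: R ∧ ∀ m ∈ Q, m ∉ P ++ [s] ∧ m ∉ s' :: R := by
  simp only [List.nodup_append, List.nodup_cons, List.mem_append, List.mem_cons,
    List.not_mem_nil, or_false] at h ⊢
  grind

lemma List.exists_between_of_three {P Q R : List V} {s s' : V} {T : V → Prop}
    (hT : ∀ d, T d → d ∈ P ++ s :: (Q ++ s' :: R)) (hP : ∀ a ∈ P, ¬ T a) (hR : ∀ a ∈ R, ¬ T a)
    {d₁ d₂ d₃ : V} (n₁ : d₁ ≠ d₂) (n₂ : d₁ ≠ d₃) (n₃ : d₂ ≠ d₃) (h₁ : T d₁) (h₂ : T d₂)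
    (h₃ : T d₃) : ∃ m ∈ Q, T m := by
  have hQ : ∀ d, T d → d = s ∨ d = s' ∨ d ∈ Q := fun d hd => by
    have := hT d hd
    have a := hP d
    have b := hR d
    simp only [List.mem_append, List.mem_cons] at this
    tauto
  have r₁ := hQ _ h₁
  have r₂ := hQ _ h₂
  have r₃ := hQ _ h₃
  clear hT hP hR hQ
  grind

set_option maxHeartbeats 400000 in
lemma IsEar.cover_of_maximal (hO : SetConn K (O : Set V)) (h : IsEar K O H E c c')
    (h3 : ∀ Y : Set V, Y ⊆ O → Y ≠ O → Y.Nonempty → ∃ d₁ d₂ d₃, d₁ ≠ d₂ ∧ d₁ ≠ d₃ ∧ d₂ ≠ d₃ ∧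
      ∀ d, d = d₁ ∨ d = d₂ ∨ d = d₃ → d ∉ Y ∧ ∃ y ∈ Y, K.Adj y d)
    (hmax : ∀ H' E' d d', IsEar K O H' E' d d' → H'.card ≤ H.card) :
    ∀ x ∈ O, x ∈ H ∨ x ∈ E := by
  classical
  by_contra! hz
  obtain ⟨z, hzO, hzH, hzE⟩ := hz
  have grow : ∀ w, w ∈ O → w ∉ H → w ∉ E → (H = ∅ ∨ ∃ u ∈ H, K.Adj w u) → False := by
    intro w hwO hwH hwE hw
    have : IsEar K O (insert w H) E c c' := by
      refine { h with mem := fun x hx => ⟨(h.mem x hx).1, ?_⟩, sub := ?_, conn := Or.inr ?_ }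
      · rw [Finset.mem_insert, not_or]
        exact ⟨fun e => hwE (e ▸ hx), (h.mem x hx).2⟩
      · exact Finset.insert_subset hwO h.sub
      · rw [Finset.coe_insert]
        rcases hw with rfl | ⟨u, hu, hwu⟩
        · simpa using SetConn.singleton w
        · refine SetConn.insert_adj (h.conn.resolve_left ?_) (Finset.mem_coe.2 hu) hwu
          rintro rfl; simp at hu
    have := hmax _ _ _ _ this
    rw [Finset.card_insert_of_notMem hwH] at this
    omega
  have hHne : H ≠ ∅ := fun e => grow z hzO hzH hzE (Or.inl e)
  obtain ⟨u₀, hu₀⟩ := Finset.nonempty_iff_ne_empty.2 hHne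
  have hHc := h.conn.resolve_left hHne
  set S : Set V := {s | s ∈ E ∧ ∃ u ∈ H, K.Adj s u} with hS
  have hSO : ∀ s ∈ S, s ∈ O := fun s hs => (h.mem s hs.1).1
  -- an ear avoiding a vertex of `S` would allow `H` to grow
  have hF : ∀ F : Set V, SetConn K F → (∀ x ∈ F, x ∈ O ∧ x ∉ H) → ∀ s ∈ S, s ∉ F →
      ∀ d d', d ∉ O → d' ∉ O → d ≠ d' → (∃ x ∈ F, K.Adj x d) → (∃ x ∈ F, K.Adj x d') → False := by
    intro F hFc hFO s hs hsF d d' hd hd' hne hxd hxd'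
    obtain ⟨hsE, u, hu, hsu⟩ := hs
    have hsH := (h.mem s hsE).2
    obtain ⟨E', hE', -⟩ := hFc.exists_isEar (H := insert s H) (O := O) (c := d) (c' := d')
      (fun x hx => ⟨(hFO x hx).1, by
        rw [Finset.mem_insert, not_or]
        exact ⟨fun e => hsF (e ▸ hx), (hFO x hx).2⟩⟩)
      (Finset.insert_subset (h.mem s hsE).1 h.sub)
      (Or.inr (by
        rw [Finset.coe_insert]
        exact hHc.insert_adj (Finset.mem_coe.2 hu) hsu)) hd hd' hne hxd hxd'
    have := hmax _ _ _ _ hE'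
    rw [Finset.card_insert_of_notMem hsH] at this
    omega
  obtain ⟨u, -, s₀, hs₀O, huH, hs₀H, hus₀⟩ := hO.exists_boundary_adj (T := (H : Set V))
    (h.sub hu₀) hu₀ hzO hzH
  have hs₀ : s₀ ∈ S := by
    refine ⟨?_, u, huH, hus₀.symm⟩
    by_contra hs₀E
    exact grow s₀ hs₀O hs₀H hs₀E (Or.inr ⟨u, huH, hus₀.symm⟩)
  set W : Set V := {x | x ∈ O ∧ x ∉ H ∧ x ∉ S}
  have hzW : z ∈ W := ⟨hzO, hzH, fun hzS => hzE hzS.1⟩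
  obtain ⟨Z, hzZ, hZW, hZc, hZcl⟩ : ∃ Z : Set V, z ∈ Z ∧ Z ⊆ W ∧ SetConn K Z ∧
      ∀ x ∈ Z, ∀ y ∈ W, K.Adj x y → y ∈ Z :=
    ⟨setComp K W z, mem_setComp_self, setComp_subset hzW, setConn_setComp,
      fun x hx y hy hxy => setComp_closed hzW hx hxy hy⟩
  have hZO : ∀ x ∈ Z, x ∈ O ∧ x ∉ H := fun x hx => ⟨(hZW hx).1, (hZW hx).2.1⟩
  have hZN : ∀ x ∈ Z, ∀ y, y ∉ Z → K.Adj x y → y ∈ S ∨ y ∉ O := by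
    intro x hx y hy hxy
    by_contra! hyS
    have hyH : y ∈ H := by
      by_contra hyH
      exact hy (hZcl x hx y ⟨hyS.2, hyH, hyS.1⟩ hxy)
    by_cases hxE : x ∈ E
    · exact (hZW hx).2.2 ⟨hxE, y, hyH, hxy⟩
    · exact grow x (hZW hx).1 (hZW hx).2.1 hxE (Or.inr ⟨y, hyH, hxy⟩)
  obtain ⟨d₁, d₂, d₃, n₁, n₂, n₃, hd⟩ := h3 Z (fun x hx => (hZW hx).1)
    (fun e => (hZW (e ▸ Finset.mem_coe.2 (h.sub hu₀) : u₀ ∈ Z)).2.1 hu₀) ⟨z, hzZ⟩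
  have hdZ : ∀ d, d = d₁ ∨ d = d₂ ∨ d = d₃ → (d ∈ S ∨ d ∉ O) ∧ ∃ y ∈ Z, K.Adj y d := by
    intro d hd'
    obtain ⟨hdn, y, hy, hyd⟩ := hd d hd'
    exact ⟨hZN y hy d hdn hyd, y, hy, hyd⟩
  have hout : ∀ d d', d ∉ O → d' ∉ O → d ≠ d' → (∃ y ∈ Z, K.Adj y d) → (∃ y ∈ Z, K.Adj y d') →
      False := fun d d' hd hd' hne hyd hyd' =>
    hF Z hZc hZO s₀ hs₀ (fun h => (hZW h).2.2 hs₀) d d' hd hd' hne hyd hyd'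
  let T : V → Prop := fun s => s ∈ S ∧ ∃ y ∈ Z, K.Adj y s
  have hdT : ∀ d, d = d₁ ∨ d = d₂ ∨ d = d₃ → T d ∨ d ∉ O := fun d hd =>
    (hdZ d hd).1.imp_left fun h => ⟨h, (hdZ d hd).2⟩
  obtain ⟨x, y, hxy, hTx, hTy⟩ : ∃ x y, x ≠ y ∧ T x ∧ T y := by
    have z₁ := (hdZ d₁ (by simp)).2
    have z₂ := (hdZ d₂ (by simp)).2
    have z₃ := (hdZ d₃ (by simp)).2
    rcases hdT d₁ (by simp) with t₁ | q₁
    · rcases hdT d₂ (by simp) with t₂ | q₂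
      · exact ⟨d₁, d₂, n₁, t₁, t₂⟩
      · rcases hdT d₃ (by simp) with t₃ | q₃
        · exact ⟨d₁, d₃, n₂, t₁, t₃⟩
        · exact (hout d₂ d₃ q₂ q₃ n₃ z₂ z₃).elim
    · rcases hdT d₂ (by simp) with t₂ | q₂
      · rcases hdT d₃ (by simp) with t₃ | q₃
        · exact ⟨d₂, d₃, n₃, t₂, t₃⟩
        · exact (hout d₁ d₃ q₁ q₃ n₂ z₁ z₃).elim
      · exact (hout d₁ d₂ q₁ q₂ n₁ z₁ z₂).elim
  obtain ⟨P, s, Q, s', R, hE, hTs, hTs', hP, hR⟩ :=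
    List.exists_eq_append_first_last hTx.1.1 hTy.1.1 hxy hTx hTy
  have hnd := h.nodup
  have hch := h.chain
  have hmem := h.mem
  obtain ⟨x₁, hx₁, hx₁c⟩ := h.head
  obtain ⟨x₂, hx₂, hx₂c⟩ := h.last
  have e' : P ++ s :: (Q ++ s' :: R) = (P ++ s :: Q) ++ s' :: R := by simp
  have hx₁' : x₁ ∈ P ++ [s] := by
    rw [hE] at hx₁
    rcases P with _ | ⟨p, P⟩
    · simp at hx₁; simp [hx₁]
    · simp at hx₁; simp [hx₁]
  have hx₂' : x₂ ∈ s' :: R := by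
    rw [hE, e', List.getLast?_append_cons] at hx₂
    exact List.mem_of_getLast? hx₂
  rw [hE] at hnd hch hmem
  have hP₁ := (List.isChain_split.1 hch).1
  rw [e'] at hch
  have hR₁ := (List.isChain_split.1 hch).2
  obtain ⟨y₁, hy₁, hys⟩ := hTs.2
  obtain ⟨y₂, hy₂, hys'⟩ := hTs'.2
  have hFl : SetConn K ({x | x ∈ P ++ [s]} ∪ Z) :=
    (SetConn.of_isChain' hP₁ (by simp)).union_adj hZc (x := s) (by simp) hy₁ hys.symm
  have hFr : SetConn K (Z ∪ {x | x ∈ s' :: R}) :=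
    hZc.union_adj (SetConn.of_isChain hR₁) hy₂ (by simp) hys'
  have hmem₁ : ∀ x ∈ P ++ [s], x ∈ O ∧ x ∉ H := fun x hx => hmem x (by
    rw [e', List.mem_append]
    rw [List.mem_append] at hx
    rcases hx with hx | hx
    · exact Or.inl (List.mem_append_left _ hx)
    · exact Or.inl (List.mem_append_right _ (by
        rw [List.mem_singleton.1 hx]; exact List.mem_cons_self)))
  have hmem₂ : ∀ x ∈ s' :: R, x ∈ O ∧ x ∉ H := fun x hx => hmem x (by
    rw [e']; exact List.mem_append_right _ hx)
  obtain ⟨hs'n, hsn, hmid⟩ := hnd.split_two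
  have hSZ : ∀ s ∈ S, s ∉ Z := fun s hs h => (hZW h).2.2 hs
  by_cases hex : ∃ d, d ∉ O ∧ ∃ y ∈ Z, K.Adj y d
  · obtain ⟨d, hdO, y, hy, hyd⟩ := hex
    by_cases hdc : d = c
    · refine hF _ hFr ?_ s hTs.1 ?_ d c' hdO h.right_notMem (hdc ▸ h.ne) ⟨y, Or.inl hy, hyd⟩
        ⟨x₂, Or.inr hx₂', hx₂c⟩
      · rintro x (hx | hx)
        exacts [hZO x hx, hmem₂ x hx]
      · rintro (hx | hx)
        exacts [hSZ s hTs.1 hx, hsn hx]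
    · refine hF _ hFl ?_ s' hTs'.1 ?_ d c hdO h.left_notMem hdc ⟨y, Or.inr hy, hyd⟩
        ⟨x₁, Or.inl hx₁', hx₁c⟩
      · rintro x (hx | hx)
        exacts [hmem₁ x hx, hZO x hx]
      · rintro (hx | hx)
        exacts [hs'n hx, hSZ s' hTs'.1 hx]
  · have hdT' : ∀ d, d = d₁ ∨ d = d₂ ∨ d = d₃ → T d := fun d hd =>
      (hdT d hd).resolve_right fun hdO => hex ⟨d, hdO, (hdZ d hd).2⟩
    obtain ⟨m, hm, hTm⟩ := List.exists_between_of_three (fun d (hd : T d) => hE ▸ hd.1.1) hP hR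
      n₁ n₂ n₃ (hdT' d₁ (by simp)) (hdT' d₂ (by simp)) (hdT' d₃ (by simp))
    refine hF _ (hFl.union_inter hFr (x := y₁) (Or.inr hy₁) (Or.inl hy₁)) ?_ m hTm.1 ?_ c c'
      h.left_notMem h.right_notMem h.ne ⟨x₁, Or.inl (Or.inl hx₁'), hx₁c⟩
      ⟨x₂, Or.inr (Or.inr hx₂'), hx₂c⟩
    · rintro x ((hx | hx) | hx | hx)
      exacts [hmem₁ x hx, hZO x hx, hZO x hx, hmem₂ x hx]
    · rintro ((hx | hx) | hx | hx)
      · exact (hmid m hm).1 hx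
      · exact hSZ m hTm.1 hx
      · exact hSZ m hTm.1 hx
      · exact (hmid m hm).2 hx

lemma exists_isGoodEar (hO : SetConn K (O : Set V))
    (h3 : ∀ Y : Set V, Y ⊆ O → Y ≠ O → Y.Nonempty → ∃ d₁ d₂ d₃, d₁ ≠ d₂ ∧ d₁ ≠ d₃ ∧ d₂ ≠ d₃ ∧
      ∀ d, d = d₁ ∨ d = d₂ ∨ d = d₃ → d ∉ Y ∧ ∃ y ∈ Y, K.Adj y d)
    (h2 : ∃ d d', d ≠ d' ∧ d ∉ O ∧ d' ∉ O ∧ (∃ x ∈ O, K.Adj x d) ∧ ∃ x ∈ O, K.Adj x d') :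
    ∃ H E c c', IsGoodEar K O H E c c' := by
  obtain ⟨d, d', hne, hd, hd', hx, hx'⟩ := h2
  obtain ⟨E₀, hE₀, -⟩ := hO.exists_isEar (H := ∅) (O := O) (c := d) (c' := d')
    (fun x hx => ⟨hx, by simp⟩) (by simp) (Or.inl rfl) hd hd' hne hx hx'
  let f : Finset V × List V → ℕ ×ₗ ℕ := fun q => toLex (O.card - q.1.card, q.2.length)
  obtain ⟨⟨H, E⟩, ⟨c, c', h⟩, hmin⟩ := (InvImage.wf f wellFounded_lt).has_min
    {q | ∃ c c', IsEar K O q.1 q.2 c c'} ⟨(∅, E₀), d, d', hE₀⟩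
  have hmin' : ∀ H' E' e e', IsEar K O H' E' e e' → ¬ f (H', E') < f (H, E) :=
    fun H' E' e e' h' => hmin (H', E') ⟨e, e', h'⟩
  simp only [f, Prod.Lex.toLex_lt_toLex, not_or, not_and, not_lt] at hmin'
  refine ⟨H, E, c, c', h, h.cover_of_maximal hO h3 fun H' E' e e' h' => ?_,
    h.simple_of_minimal fun E' e e' h' => (hmin' H E' e e' h').2 rfl⟩
  have := (hmin' H' E' e e' h').1
  have := Finset.card_le_card h'.sub
  have := Finset.card_le_card h.sub
  omega

end Ear

section Leaf

variable {V : Type*} {G : SimpleGraph V} {O : Finset V} {a b : V}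

/-- All neighbours of `Y` outside `Y` are among `r`, `s`. -/
def NbrsAmong (G : SimpleGraph V) (Y : Finset V) (r s : V) : Prop :=
  ∀ y ∈ Y, ∀ z, G.Adj y z → z ∈ Y ∨ z = r ∨ z = s

/-- `O` is a set of nonisolated vertices attached to the rest of the graph only at `a` and `b`,
which are linked outside `O`. -/
structure IsFragment (G : SimpleGraph V) (a b : V) (O : Finset V) : Prop where
  ne : a ≠ b
  nonempty : O.Nonempty
  left_notMem : a ∉ O
  right_notMem : b ∉ O
  nonisolated : ∀ x ∈ O, ∃ y, G.Adj x y
  nbrs : NbrsAmong G O a b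
  link : ∃ W : Set V, SetConn G W ∧ a ∈ W ∧ b ∈ W ∧ ∀ x ∈ W, x ∉ O

variable (hdeg : ∀ v w, G.Adj v w → ∀ r s, ∃ u, G.Adj v u ∧ u ≠ r ∧ u ≠ s)

include hdeg

lemma exists_isFragment [Fintype V] (hab : G.Adj a b) : ∃ O, IsFragment G a b O := by
  classical
  refine ⟨univ.filter fun x => (∃ y, G.Adj x y) ∧ x ≠ a ∧ x ≠ b, hab.ne, ?_, by simp, by simp,
    ?_, ?_, {x | x ∈ [a, b]}, SetConn.of_isChain (by simpa using hab), by simp, by simp, ?_⟩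
  · obtain ⟨u, hu, hua, hub⟩ := hdeg a b hab a b
    exact ⟨u, by simpa using ⟨⟨a, hu.symm⟩, hua, hub⟩⟩
  · intro x hx
    exact (Finset.mem_filter.1 hx).2.1
  · intro y _ z hyz
    simp only [Finset.mem_filter, Finset.mem_univ, true_and]
    by_cases hza : z = a
    · exact Or.inr (Or.inl hza)
    by_cases hzb : z = b
    · exact Or.inr (Or.inr hzb)
    exact Or.inl ⟨⟨y, hyz.symm⟩, hza, hzb⟩
  · intro x hx
    simp only [Set.mem_ofPred_eq, List.mem_cons, List.not_mem_nil, or_false] at hx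
    simp only [Finset.mem_filter, Finset.mem_univ, true_and]
    tauto

lemma NbrsAmong.exists_smaller {Y : Finset V} {r : V} (hY : NbrsAmong G Y r r)
    (hne : Y.Nonempty) (hiso : ∀ x ∈ Y, ∃ y, G.Adj x y) :
    ∃ a b O, IsFragment G a b O ∧ O.card < Y.card := by
  classical
  by_cases hr : ∃ t ∈ Y, G.Adj t r ∧ r ∉ Y
  · obtain ⟨t, ht, htr, hrY⟩ := hr
    refine ⟨t, r, Y.erase t, ⟨htr.ne, ?_, by simp, fun h => hrY (Finset.mem_of_mem_erase h),
      fun x hx => hiso x (Finset.mem_of_mem_erase hx), ?_, {x | x ∈ [t, r]},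
      SetConn.of_isChain (by simpa using htr), by simp, by simp, ?_⟩,
        Finset.card_erase_lt_of_mem ht⟩
    · obtain ⟨u, hu, hur, -⟩ := hdeg t r htr r r
      have := hY t ht u hu
      exact ⟨u, Finset.mem_erase.2 ⟨hu.ne', by tauto⟩⟩
    · intro y hy z hyz
      have := hY y (Finset.mem_of_mem_erase hy) z hyz
      rw [Finset.mem_erase]
      tauto
    · intro x hx
      simp only [Set.mem_ofPred_eq, List.mem_cons, List.not_mem_nil, or_false] at hx
      rcases hx with rfl | rfl
      · simp
      · exact fun h => hrY (Finset.mem_of_mem_erase h)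
  · have hcl : ∀ y ∈ Y, ∀ z, G.Adj y z → z ∈ Y := by
      intro y hy z hyz
      by_contra hz
      have := hY y hy z hyz
      have hzr : z = r := by tauto
      exact hr ⟨y, hy, hzr ▸ hyz, hzr ▸ hz⟩
    obtain ⟨t, ht⟩ := hne
    obtain ⟨t', htt'⟩ := hiso t ht
    refine ⟨t, t', (Y.erase t).erase t', ⟨htt'.ne, ?_, by simp, by simp,
      fun x hx => hiso x (Finset.mem_of_mem_erase (Finset.mem_of_mem_erase hx)), ?_,
      {x | x ∈ [t, t']}, SetConn.of_isChain (by simpa using htt'), by simp, by simp, ?_⟩,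
      (Finset.card_le_card (Finset.erase_subset _ _)).trans_lt (Finset.card_erase_lt_of_mem ht)⟩
    · obtain ⟨u, hu, hur, -⟩ := hdeg t t' htt' t' t'
      exact ⟨u, Finset.mem_erase.2 ⟨hur, Finset.mem_erase.2 ⟨hu.ne', hcl t ht u hu⟩⟩⟩
    · intro y hy z hyz
      have := hcl y (Finset.mem_of_mem_erase (Finset.mem_of_mem_erase hy)) z hyz
      rw [Finset.mem_erase, Finset.mem_erase]
      tauto
    · intro x hx
      simp only [Set.mem_ofPred_eq, List.mem_cons, List.not_mem_nil, or_false] at hx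
      rcases hx with rfl | rfl <;> simp

omit hdeg in
lemma NbrsAmong.swap {Y : Finset V} {r s : V} (h : NbrsAmong G Y r s) : NbrsAmong G Y s r :=
  fun y hy z hyz => (h y hy z hyz).imp_right Or.symm

variable (h : IsFragment G a b O) (hmin : ∀ a' b' O', IsFragment G a' b' O' → O.card ≤ O'.card)

include h hmin

omit h in
lemma IsFragment.not_nbrsAmong_self {Y : Finset V} {r : V} (hne : Y.Nonempty)
    (hiso : ∀ x ∈ Y, ∃ y, G.Adj x y) (hc : Y.card ≤ O.card) : ¬ NbrsAmong G Y r r := by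
  intro hY
  obtain ⟨a', b', O', h', hlt⟩ := hY.exists_smaller hdeg hne hiso
  exact absurd (hmin _ _ _ h') (by omega)

lemma IsFragment.not_nbrsAmong_aux [Fintype V] {Y : Finset V} (hYO : Y ⊆ O) (hne : Y.Nonempty)
    {r s : V} (hr : r ∉ Y) (hs : s ∉ Y) (hY : NbrsAmong G Y r s)
    (hrs : r ∉ setComp G {x | x ∉ Y} s) (ha : a ∉ setComp G {x | x ∉ Y} s) : False := by
  classical
  obtain ⟨W, hWc, haW, hbW, hWO⟩ := h.link
  set C := setComp G {x | x ∉ Y} s with hC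
  have hCY : ∀ x ∈ C, x ∉ Y := fun x hx => setComp_subset (by exact hs) hx
  have hcl : ∀ x ∈ C, ∀ y, y ∉ Y → G.Adj x y → y ∈ C := fun x hx y hy hxy =>
    setComp_closed (by exact hs) hx hxy hy
  have hb : b ∉ C := by
    intro hb
    obtain ⟨u, hu, v, hv, huC, hvC, huv⟩ := hWc.exists_boundary_adj hbW hb haW ha
    exact hvC (hcl u huC v (fun hv' => hWO v hv (hYO hv')) huv)
  have hisoO := h.nonisolated
  have hsO : s ∈ O := by
    by_contra hsO
    have hsab : s ≠ a ∧ s ≠ b :=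
      ⟨fun e => ha (e ▸ mem_setComp_self), fun e => hb (e ▸ mem_setComp_self)⟩
    refine IsFragment.not_nbrsAmong_self hdeg hmin (r := r) hne (fun x hx => hisoO x (hYO hx))
      (Finset.card_le_card hYO) fun y hy z hyz => ?_
    have h1 := hY y hy z hyz
    have h2 := h.nbrs y (hYO hy) z hyz
    rcases h1 with h1 | h1 | rfl
    · exact Or.inl h1
    · exact Or.inr (Or.inl h1)
    · tauto
  have hCO : ∀ x ∈ C, x ∈ O := by
    intro x hx
    by_contra hxO
    obtain ⟨u, hu, v, hv, huO, hvO, huv⟩ := (setConn_setComp (G := G)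
      (S := {x | x ∉ Y}) (x := s)).exists_boundary_adj (T := (O : Set V)) mem_setComp_self
      hsO hx hxO
    rcases h.nbrs u huO v huv with h' | rfl | rfl
    exacts [hvO h', ha hv, hb hv]
  have hCs : ∀ x ∈ C, x = s := by
    intro x hx
    by_contra hxs
    refine IsFragment.not_nbrsAmong_self hdeg hmin (r := s)
      (Y := univ.filter fun x => x ∈ C ∧ x ≠ s)
      ⟨x, by simpa using ⟨hx, hxs⟩⟩ (fun y hy => ?_) (Finset.card_le_card fun y hy => ?_)
      fun y hy z hyz => ?_
    · exact hisoO y (hCO y (Finset.mem_filter.1 hy).2.1)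
    · exact hCO y (Finset.mem_filter.1 hy).2.1
    · obtain ⟨hyC, hys⟩ := (Finset.mem_filter.1 hy).2
      by_cases hzs : z = s
      · exact Or.inr (Or.inl hzs)
      left
      refine Finset.mem_filter.2 ⟨Finset.mem_univ _, hcl y hyC z (fun hzY => ?_) hyz, hzs⟩
      rcases hY z hzY y hyz.symm with h' | rfl | rfl
      exacts [hCY _ hyC h', hrs hyC, hys rfl]
  have hsub : insert s Y ⊆ O := Finset.insert_subset hsO hYO
  refine IsFragment.not_nbrsAmong_self hdeg hmin (r := r) (Y := insert s Y) ⟨s, by simp⟩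
    (fun x hx => hisoO x (hsub hx)) (Finset.card_le_card hsub) fun y hy z hyz => ?_
  rw [Finset.mem_insert]
  rcases Finset.mem_insert.1 hy with rfl | hy
  · by_cases hz : z ∈ Y
    · tauto
    · exact Or.inl (Or.inl (hCs z (hcl _ mem_setComp_self z hz hyz)))
  · have := hY y hy z hyz
    tauto

lemma IsFragment.not_nbrsAmong [Fintype V] {Y : Finset V} (hYO : Y ⊂ O) (hne : Y.Nonempty)
    (r s : V) : ¬ NbrsAmong G Y r s := by
  classical
  intro hY
  have hlt := Finset.card_lt_card hYO
  have hself : ∀ r, ¬ NbrsAmong G Y r r := fun r => IsFragment.not_nbrsAmong_self hdeg hmin hne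
    (fun x hx => h.nonisolated x (hYO.1 hx)) hlt.le
  have hr : r ∉ Y := fun hr => hself s fun y hy z hyz => by
    have := hY y hy z hyz
    rcases this with h | rfl | h <;> tauto
  have hs : s ∉ Y := fun hs => hself r fun y hy z hyz => by
    have := hY y hy z hyz
    rcases this with h | h | rfl <;> tauto
  have hrs : r ≠ s := fun e => hself s (e ▸ hY)
  have hsep : r ∉ setComp G {x | x ∉ Y} s := by
    intro hmem
    have := hmin r s Y ⟨hrs, hne, hr, hs, fun x hx => h.nonisolated x (hYO.1 hx), hY,
      setComp G {x | x ∉ Y} s, setConn_setComp, hmem, mem_setComp_self,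
      fun x hx => setComp_subset (by exact hs) hx⟩
    omega
  have hsep' : s ∉ setComp G {x | x ∉ Y} r := by
    intro hmem
    have := hmin r s Y ⟨hrs, hne, hr, hs, fun x hx => h.nonisolated x (hYO.1 hx), hY,
      setComp G {x | x ∉ Y} r, setConn_setComp, mem_setComp_self, hmem,
      fun x hx => setComp_subset (by exact hr) hx⟩
    omega
  by_cases ha : a ∈ setComp G {x | x ∉ Y} s
  · refine h.not_nbrsAmong_aux hdeg hmin hYO.1 hne hs hr hY.swap hsep' fun ha' => ?_
    have hc := (setConn_setComp (G := G) (S := {x | x ∉ Y}) (x := s)).union_inter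
      (setConn_setComp (G := G) (S := {x | x ∉ Y}) (x := r)) ha ha'
    have := hmin r s Y ⟨hrs, hne, hr, hs, fun x hx => h.nonisolated x (hYO.1 hx), hY,
      _, hc, Or.inr mem_setComp_self, Or.inl mem_setComp_self, fun x hx => ?_⟩
    · omega
    · rcases hx with hx | hx
      exacts [setComp_subset (by exact hs) hx, setComp_subset (by exact hr) hx]
  · exact h.not_nbrsAmong_aux hdeg hmin hYO.1 hne hr hs hY hsep ha

lemma IsFragment.exists_three [Fintype V] {Y : Set V} (hYO : Y ⊆ O) (hne' : Y ≠ O)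
    (hne : Y.Nonempty) : ∃ d₁ d₂ d₃, d₁ ≠ d₂ ∧ d₁ ≠ d₃ ∧ d₂ ≠ d₃ ∧
      ∀ d, d = d₁ ∨ d = d₂ ∨ d = d₃ → d ∉ Y ∧ ∃ y ∈ Y, G.Adj y d := by
  classical
  lift Y to Finset V using Set.toFinite Y
  have hYO' : Y ⊂ O := (Finset.ssubset_iff_subset_ne).2
    ⟨Finset.coe_subset.1 hYO, fun e => hne' (by rw [e])⟩
  have key : ∀ r s, ∃ d, d ≠ r ∧ d ≠ s ∧ d ∉ Y ∧ ∃ y ∈ Y, G.Adj y d := by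
    intro r s
    have := h.not_nbrsAmong hdeg hmin hYO' (Finset.coe_nonempty.1 hne) r s
    simp only [NbrsAmong, not_forall, not_or] at this
    obtain ⟨y, hy, z, hyz, h1, h2, h3⟩ := this
    exact ⟨z, h2, h3, h1, y, hy, hyz⟩
  obtain ⟨d₁, -, -, h₁⟩ := key a a
  obtain ⟨d₂, h₂₁, -, h₂⟩ := key d₁ d₁
  obtain ⟨d₃, h₃₁, h₃₂, h₃⟩ := key d₁ d₂
  refine ⟨d₁, d₂, d₃, h₂₁.symm, h₃₁.symm, h₃₂.symm, ?_⟩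
  rintro d (rfl | rfl | rfl)
  exacts [by simpa using h₁, by simpa using h₂, by simpa using h₃]

lemma IsFragment.exists_adj_left : ∃ x ∈ O, G.Adj x a := by
  by_contra! hc
  refine IsFragment.not_nbrsAmong_self hdeg hmin (r := b) h.nonempty h.nonisolated le_rfl
    fun y hy z hyz => ?_
  rcases h.nbrs y hy z hyz with h' | rfl | h'
  exacts [Or.inl h', (hc y hy hyz).elim, Or.inr (Or.inl h')]

lemma IsFragment.exists_adj_right : ∃ x ∈ O, G.Adj x b := by
  by_contra! hc
  refine IsFragment.not_nbrsAmong_self hdeg hmin (r := a) h.nonempty h.nonisolated le_rfl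
    fun y hy z hyz => ?_
  rcases h.nbrs y hy z hyz with h' | h' | rfl
  exacts [Or.inl h', Or.inr (Or.inl h'), (hc y hy hyz).elim]

lemma IsFragment.setConn [Fintype V] : SetConn G (O : Set V) := by
  obtain ⟨x, hx⟩ := h.nonempty
  have hx' : x ∈ (O : Set V) := hx
  by_cases e : setComp G O x = O
  · rw [← e]; exact setConn_setComp
  · obtain ⟨d₁, d₂, d₃, n₁, n₂, n₃, hd⟩ := h.exists_three hdeg hmin (setComp_subset hx') e
      ⟨x, mem_setComp_self⟩
    have key : ∀ d, d = d₁ ∨ d = d₂ ∨ d = d₃ → d = a ∨ d = b := by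
      intro d hd'
      obtain ⟨hdn, y, hy, hyd⟩ := hd d hd'
      refine (h.nbrs y (setComp_subset hx' hy) d hyd).resolve_left fun hdO => ?_
      exact hdn (setComp_closed hx' hy hyd hdO)
    have k₁ := key d₁ (by simp)
    have k₂ := key d₂ (by simp)
    have k₃ := key d₃ (by simp)
    grind

end Leaf

section Torso

variable {V : Type*} {G : SimpleGraph V} {O : Finset V} {a b : V}

/-- The edges of `G` meeting `O`, together with the edge `ab`. -/
def torso (G : SimpleGraph V) (O : Finset V) (a b : V) : SimpleGraph V where
  Adj x y := x ≠ y ∧ (G.Adj x y ∧ (x ∈ O ∨ y ∈ O) ∨ x = a ∧ y = b ∨ x = b ∧ y = a)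
  symm := ⟨fun x y h => ⟨h.1.symm, by
    have := G.adj_comm x y
    have := h.2
    tauto⟩⟩
  loopless := ⟨fun x h => h.1 rfl⟩

lemma torso_adj_of_mem {x y : V} (hx : x ∈ O) (h : G.Adj x y) : (torso G O a b).Adj x y :=
  ⟨h.ne, Or.inl ⟨h, Or.inl hx⟩⟩

lemma torso_adj_iff_of_mem (ha : a ∉ O) (hb : b ∉ O) {x y : V} (hx : x ∈ O) :
    (torso G O a b).Adj x y ↔ G.Adj x y := by
  refine ⟨fun h => ?_, torso_adj_of_mem hx⟩
  rcases h.2 with h | ⟨rfl, -⟩ | ⟨rfl, -⟩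
  exacts [h.1, (ha hx).elim, (hb hx).elim]

lemma HasMinor.of_torso (h : IsFragment G a b O) {U : Type*} {H : SimpleGraph U}
    (hH : ∀ u, ∃ w, H.Adj u w) (hm : HasMinor (torso G O a b) H) : HasMinor G H := by
  classical
  obtain ⟨S, hSc, hSd, hSa⟩ := hm
  obtain ⟨W₀, hWc, haW, hbW, hWO⟩ := h.link
  have haW' : a ∈ W₀ \ {b} := ⟨haW, h.ne⟩
  set W := setComp G (W₀ \ {b}) a with hW
  have hWs : W ⊆ W₀ \ {b} := setComp_subset haW'
  obtain ⟨z, hz, hzb⟩ : ∃ z ∈ W, G.Adj z b := by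
    obtain ⟨u, hu, v, hv, huW, hvW, huv⟩ := hWc.exists_boundary_adj (T := W) haW
      mem_setComp_self hbW fun hb => (hWs hb).2 rfl
    refine ⟨u, huW, ?_⟩
    by_cases hvb : v = b
    · exact hvb ▸ huv
    · exact (hvW (setComp_closed haW' huW huv ⟨hv, hvb⟩)).elim
  have hWconn : SetConn G W := setConn_setComp
  have hadj : ∀ u, ∀ x ∈ S u, ∃ y, (torso G O a b).Adj x y := by
    intro u x hx
    obtain ⟨w, hw⟩ := hH u
    obtain ⟨x', hx', y, -, hxy⟩ := hSa u w hw
    rcases ((hSc u).2 x hx x' hx').cases_head with rfl | ⟨c, hc, -⟩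
    exacts [⟨y, hxy⟩, ⟨c, hc.1⟩]
  have hSW : ∀ u, ∀ x ∈ S u, x ∈ W → x = a := by
    intro u x hx hxW
    obtain ⟨y, hxy⟩ := hadj u x hx
    have hxO := hWO x (hWs hxW).1
    rcases hxy.2 with ⟨hG, h' | hyO⟩ | h' | h'
    · exact (hxO h').elim
    · rcases h.nbrs y hyO x hG.symm with h' | h' | h'
      exacts [(hxO h').elim, h', ((hWs hxW).2 h').elim]
    · exact h'.1
    · exact ((hWs hxW).2 h'.1).elim
  let S' : U → Set V := fun u => if a ∈ S u then S u ∪ W else S u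
  have hsub : ∀ u, S u ⊆ S' u := fun u x hx => by
    simp only [S']; split_ifs
    exacts [Or.inl hx, hx]
  have hS'W : ∀ u, a ∈ S u → W ⊆ S' u := fun u ha x hx => by
    simp only [S', if_pos ha]
    exact Or.inr hx
  refine ⟨S', fun u => ?_, fun u w huw => ?_, fun u w huw => ?_⟩
  · by_cases ha : a ∈ S u
    · refine SetConn.of_root (hsub u ha) fun x hx => ?_
      have hWr : ∀ x ∈ W, Relation.ReflTransGen
          (fun u' v => G.Adj u' v ∧ u' ∈ S' u ∧ v ∈ S' u) a x := fun x hx =>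
        Relation.ReflTransGen.mono (fun _ _ h => ⟨h.1, hS'W u ha h.2.1, hS'W u ha h.2.2⟩) _ _
          (hWconn.2 a mem_setComp_self x hx)
      have hx' : x ∈ S u ∨ x ∈ W := by
        simp only [S', if_pos ha] at hx
        exact hx
      rcases hx' with hx' | hx'
      · have := (hSc u).2 a ha x hx'
        clear hx hx'
        induction this with
        | refl => exact .refl
        | @tail p q _ hpq ih =>
          rcases hpq.1.2 with h' | ⟨rfl, rfl⟩ | ⟨rfl, rfl⟩
          · exact ih.tail ⟨h'.1, hsub u hpq.2.1, hsub u hpq.2.2⟩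
          · exact (hWr z hz).tail ⟨hzb, hS'W u ha hz, hsub u hpq.2.2⟩
          · exact .refl
      · exact hWr x hx'
    · simp only [S', if_neg ha]
      refine (hSc u).mono_graph fun x hx y hy hxy => ?_
      rcases hxy.2 with h' | ⟨rfl, rfl⟩ | ⟨rfl, rfl⟩
      exacts [h'.1, (ha hx).elim, (ha hy).elim]
  · rw [Set.disjoint_left]
    intro x hx hx'
    have hd := hSd u w huw
    rw [Set.disjoint_left] at hd
    by_cases h1 : x ∈ S u <;> by_cases h2 : x ∈ S w
    · exact hd h1 h2
    · simp only [S'] at hx'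
      split_ifs at hx' with h3
      · exact hd ((hSW u x h1 (hx'.resolve_left h2)) ▸ h1) h3
      · exact h2 hx'
    · simp only [S'] at hx
      split_ifs at hx with h3
      · exact hd h3 ((hSW w x h2 (hx.resolve_left h1)) ▸ h2)
      · exact h1 hx
    · simp only [S'] at hx hx'
      split_ifs at hx hx' with h3 h4 h5
      exacts [hd h3 h4, h2 hx', h1 hx, h1 hx]
  · obtain ⟨x, hx, y, hy, hxy⟩ := hSa u w huw
    rcases hxy.2 with h' | ⟨rfl, rfl⟩ | ⟨rfl, rfl⟩
    · exact ⟨x, hsub u hx, y, hsub w hy, h'.1⟩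
    · exact ⟨z, hS'W u hx hz, _, hsub w hy, hzb⟩
    · exact ⟨_, hsub u hx, z, hS'W w hy hz, hzb.symm⟩

end Torso

section Potential

variable {V : Type*} {K : SimpleGraph V} {ω : V → ℤ}

lemma cycle_chain_append_iff {c c' : V} {E S : List V} :
    Cycle.Chain K.Adj (c :: (E ++ c' :: S) : List V) ↔
      (c :: (E ++ [c'])).IsChain K.Adj ∧ (c' :: (S ++ [c])).IsChain K.Adj := by
  rw [Cycle.chain_coe_cons]
  have e : c :: (E ++ c' :: S ++ [c]) = (c :: E) ++ c' :: (S ++ [c]) := by simp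
  rw [e, List.isChain_split]
  simp

lemma isChain_reverse_iff {l : List V} : l.reverse.IsChain K.Adj ↔ l.IsChain K.Adj := by
  rw [List.isChain_reverse]
  have : (fun a b => K.Adj b a) = K.Adj := by
    funext x y
    exact propext (K.adj_comm y x)
  rw [this]

lemma isChain_ear {c c' : V} {E : List V} (hE : E.IsChain K.Adj)
    (h₁ : ∃ x, E.head? = some x ∧ K.Adj x c) (h₂ : ∃ x, E.getLast? = some x ∧ K.Adj x c') :
    (c :: (E ++ [c'])).IsChain K.Adj := by
  obtain ⟨x, hx, hxc⟩ := h₁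
  obtain ⟨y, hy, hyc⟩ := h₂
  rw [List.isChain_cons]
  refine ⟨fun z hz => ?_, List.isChain_append.2 ⟨hE, by simp, fun z hz w hw => ?_⟩⟩
  · rw [List.head?_append, hx] at hz
    simp at hz
    exact hz ▸ hxc.symm
  · simp at hz hw
    rw [hy] at hz
    simp at hz
    subst hz hw
    exact hyc

open Classical in
lemma spaced_sum_nonneg (hface : ∀ l : List V, 3 ≤ l.length → l.Nodup →
      Cycle.Chain K.Adj (l : Cycle V) → 60 ≤ (l.map ω).sum) {v c' : V} (hv' : K.Adj v c') :
    ∀ (S : List V) (c : V), (c :: (S ++ [c'])).Nodup → (c :: (S ++ [c'])).IsChain K.Adj →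
      v ∉ c :: (S ++ [c']) → K.Adj v c →
      0 ≤ ω v - 60 + ω c + ω c' + (S.map ω).sum +
        (S.map fun x => if K.Adj v x then ω v - 60 + ω x else 0).sum := by
  have face : ∀ (P : List V) (c m : V), (c :: (P ++ [m])).Nodup →
      (c :: (P ++ [m])).IsChain K.Adj → v ∉ c :: (P ++ [m]) → K.Adj v c → K.Adj v m →
      60 ≤ ω v + ω c + (P.map ω).sum + ω m := by
    intro P c m hnd hch hvn hvc hvm
    have := hface (v :: c :: (P ++ [m])) (by simp) (List.nodup_cons.2 ⟨hvn, hnd⟩) (by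
      have := (cycle_chain_append_iff (K := K) (c := v) (c' := m) (E := c :: P) (S := [])).2 ⟨?_, ?_⟩
      · simpa using this
      · exact List.isChain_cons_cons.2 ⟨hvc, hch⟩
      · simpa using hvm.symm)
    simp at this
    linarith
  intro S
  induction hn : S.length using Nat.strong_induction_on generalizing S with
  | _ n ih =>
    intro c hnd hch hvn hvc
    by_cases hS : ∃ x ∈ S, K.Adj v x
    · obtain ⟨x, hx, hvx⟩ := hS
      obtain ⟨P, m, Q, rfl, hm, hP⟩ := List.exists_eq_append_first (l := S) (P := K.Adj v) ⟨x, hx, hvx⟩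
      have e : c :: (P ++ m :: Q ++ [c']) = (c :: P) ++ m :: (Q ++ [c']) := by simp
      rw [e] at hnd hch hvn
      obtain ⟨h1, h2⟩ := List.isChain_split.1 hch
      have hnd' := List.nodup_append.1 hnd
      have hsub : ((c :: P) ++ [m]).Sublist ((c :: P) ++ m :: (Q ++ [c'])) :=
        List.Sublist.append_left (by simp) _
      have f := face P c m (by simpa using hnd.sublist hsub) (by simpa using h1)
        (fun h => hvn (hsub.subset (by simpa using h))) hvc hm
      have g := ih Q.length (by simp at hn; omega) Q rfl m hnd'.2.1 h2
        (fun h => hvn (List.mem_append_right _ h)) hm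
      have z : (P.map fun x => if K.Adj v x then ω v - 60 + ω x else 0).sum = 0 := by
        apply List.sum_eq_zero
        intro y hy
        obtain ⟨x, hx, rfl⟩ := List.mem_map.1 hy
        rw [if_neg (hP x hx)]
      simp only [List.map_append, List.map_cons, List.sum_append, List.sum_cons, z, if_pos hm]
      linarith
    · push Not at hS
      have f := face S c c' hnd hch hvn hvc hv'
      have z : (S.map fun x => if K.Adj v x then ω v - 60 + ω x else 0).sum = 0 := by
        apply List.sum_eq_zero
        intro y hy
        obtain ⟨x, hx, rfl⟩ := List.mem_map.1 hy
        rw [if_neg (hS x hx)]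
      rw [z]
      linarith

open Classical in
/-- The excess of a partially explored disc with explored vertices `D` and boundary cycle `C`. -/
noncomputable def potential (K : SimpleGraph V) (ω : V → ℤ) (D : Finset V) (C : List V) : ℤ :=
  ∑ x ∈ D, ∑ y ∈ D, (if K.Adj x y then ω x - 30 else 0) - (C.map ω).sum + 60 * (D.card - 1)

lemma potential_of_isRotated {D : Finset V} {C C' : List V} (h : C ~r C') :
    potential K ω D C = potential K ω D C' := by
  rw [potential, potential, (h.perm.map ω).sum_eq]

open Classical in
lemma sum_sum_union {D E : Finset V} (hDE : Disjoint D E) (f : V → V → ℤ) :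
    ∑ x ∈ D ∪ E, ∑ y ∈ D ∪ E, f x y = ∑ x ∈ D, ∑ y ∈ D, f x y + ∑ x ∈ D, ∑ y ∈ E, f x y +
      ∑ x ∈ E, ∑ y ∈ D ∪ E, f x y := by
  rw [Finset.sum_union hDE, ← Finset.sum_add_distrib]
  congr 1
  exact Finset.sum_congr rfl fun x _ => Finset.sum_union hDE

open Classical in
lemma le_sum_ite_of_subset {D : Finset V} {p : V → Prop} {c : ℤ} (hc : c ≤ 0) (T : Finset V)
    (hT : ∀ y ∈ D, p y → y ∈ T) : T.card * c ≤ ∑ y ∈ D, if p y then c else 0 := by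
  rw [← Finset.sum_filter, Finset.sum_const, nsmul_eq_mul]
  have h : (D.filter p).card ≤ T.card := Finset.card_le_card fun y hy => by
    obtain ⟨h1, h2⟩ := Finset.mem_filter.1 hy
    exact hT y h1 h2
  have h' : ((D.filter p).card : ℤ) ≤ T.card := by exact_mod_cast h
  nlinarith

variable (hface : ∀ l : List V, 3 ≤ l.length → l.Nodup →
      Cycle.Chain K.Adj (l : Cycle V) → 60 ≤ (l.map ω).sum)
  {D : Finset V} {c c' : V} {S S' : List V}
  (hC : Cycle.Chain K.Adj (c :: (S ++ c' :: S') : List V)) (hnd : (c :: (S ++ c' :: S')).Nodup)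
  (hCD : ∀ x ∈ c :: (S ++ c' :: S'), x ∈ D)

include hface hC hnd hCD

open Classical in
lemma potential_single {v : V} (hv : v ∉ D) (hvc : K.Adj v c) (hvc' : K.Adj v c')
    (hvD : ∀ x ∈ D, K.Adj v x → x = c ∨ x = c' ∨ x ∈ S) :
    potential K ω D (c :: (S ++ c' :: S')) ≤
      potential K ω (D ∪ [v].toFinset) (c :: ([v] ++ c' :: S')) := by
  have hsub : (c :: (S ++ [c'])).Sublist (c :: (S ++ c' :: S')) :=
    List.Sublist.cons_cons _ (List.Sublist.append_left (by simp) _)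
  have hsp := spaced_sum_nonneg hface hvc' S c (hnd.sublist hsub) (cycle_chain_append_iff.1 hC).1
    (fun h => hv (hCD v (hsub.subset h))) hvc
  have hdisj : Disjoint D [v].toFinset := by simpa using hv
  have hnd₁ := hnd.sublist hsub
  have hsum : ∑ x ∈ D, (if K.Adj v x then ω v - 60 + ω x else 0) =
      ((c :: (S ++ [c'])).map fun x => if K.Adj v x then ω v - 60 + ω x else 0).sum := by
    rw [← List.sum_toFinset _ hnd₁]
    refine (Finset.sum_subset (fun x hx => hCD x (hsub.subset (List.mem_toFinset.1 hx)))
      fun x hx hx' => if_neg fun h => hx' ?_).symm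
    have := hvD x hx h
    simp only [List.mem_toFinset, List.mem_cons, List.mem_append, List.not_mem_nil, or_false]
    tauto
  have hsplit : ∑ x ∈ D, (if K.Adj v x then ω v - 60 + ω x else 0) =
      ∑ x ∈ D, (if K.Adj x v then ω x - 30 else 0) + ∑ x ∈ D, if K.Adj v x then ω v - 30 else 0 := by
    rw [← Finset.sum_add_distrib]
    refine Finset.sum_congr rfl fun x _ => ?_
    rw [K.adj_comm x v]
    split_ifs <;> ring
  rw [potential, potential, sum_sum_union hdisj, Finset.card_union_of_disjoint hdisj]
  simp only [List.toFinset_cons, List.toFinset_nil, insert_empty_eq, Finset.sum_singleton,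
    Finset.card_singleton, List.map_append, List.map_cons, List.sum_append, List.sum_cons,
    List.map_nil, List.sum_nil]
  rw [Finset.sum_union (by simpa using hv)]
  simp only [Finset.sum_singleton, SimpleGraph.irrefl, if_false]
  simp only [List.map_append, List.map_cons, List.sum_append, List.sum_cons,
    List.map_nil, List.sum_nil, if_pos hvc, if_pos hvc'] at hsum
  push_cast
  linarith

open Classical in
lemma potential_path (hω : ∀ x, ω x ≤ 30) {E : List V} (hED : ∀ x ∈ E, x ∉ D) (hEnd : E.Nodup)
    (hEne : E ≠ []) (hE : (c :: (E ++ [c'])).IsChain K.Adj)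
    (hdeg : ∀ x ∈ E, ∃ u w, ∀ y, K.Adj x y → y ∈ E ∨ y ∈ D → y = u ∨ y = w)
    (hends : ∀ x ∈ E, ∀ y ∈ D, K.Adj x y →
      (y = c ∧ E.head? = some x) ∨ (y = c' ∧ E.getLast? = some x)) :
    potential K ω D (c :: (S ++ c' :: S')) ≤
      potential K ω (D ∪ E.toFinset) (c :: (E ++ c' :: S')) := by
  have hsub : (c :: (S ++ [c'])).Sublist (c :: (S ++ c' :: S')) :=
    List.Sublist.cons_cons _ (List.Sublist.append_left (by simp) _)
  have hnd₁ := hnd.sublist hsub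
  have hch := (cycle_chain_append_iff.1 hC).1
  have hSD : ∀ x ∈ c :: (S ++ [c']), x ∈ D := fun x hx => hCD x (hsub.subset hx)
  have hcc' : c ≠ c' := by
    rintro rfl
    simp at hnd₁
  have hcD := hSD c (by simp)
  have hcD' := hSD c' (by simp)
  have hf := hface (c :: (E ++ c' :: S.reverse)) (by
    have := List.length_pos_of_ne_nil hEne
    simp only [List.length_cons, List.length_append]
    omega) (by
    have hS : (c :: c' :: S).Nodup := by
      refine (List.Perm.nodup_iff ?_).1 hnd₁
      exact List.Perm.cons _ (List.perm_append_singleton c' S)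
    have hp : (c :: (E ++ c' :: S.reverse)).Perm (E ++ (c :: c' :: S)) := by
      refine (List.perm_middle (l₁ := E) (a := c) (l₂ := c' :: S.reverse)).symm.trans ?_
      exact List.Perm.append_left _ (((List.reverse_perm S).cons _).cons _)
    rw [hp.nodup_iff, List.nodup_append]
    refine ⟨hEnd, hS, fun x hx y hy hxy => hED x hx (hxy ▸ hSD y ?_)⟩
    simp only [List.mem_cons, List.mem_append, List.not_mem_nil, or_false] at hy ⊢
    tauto) (by
    rw [cycle_chain_append_iff]
    refine ⟨hE, ?_⟩
    rw [← isChain_reverse_iff]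
    simpa using hch)
  have hdisj : Disjoint D E.toFinset := by
    rw [Finset.disjoint_right]
    intro x hx
    exact hED x (List.mem_toFinset.1 hx)
  have h1 : ∑ x ∈ E.toFinset, (2 * ω x - 60) ≤ ∑ x ∈ E.toFinset, ∑ y ∈ D ∪ E.toFinset,
      (if K.Adj x y then ω x - 30 else 0) := by
    refine Finset.sum_le_sum fun x hx => ?_
    obtain ⟨u, w, huw⟩ := hdeg x (List.mem_toFinset.1 hx)
    have := le_sum_ite_of_subset (D := D ∪ E.toFinset) (p := K.Adj x) (c := ω x - 30)
      (by linarith [hω x]) {u, w} fun y hy hxy => by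
        have := huw y hxy (by simpa [or_comm] using hy)
        simpa using this
    have hc : (({u, w} : Finset V).card : ℤ) ≤ 2 := by exact_mod_cast Finset.card_le_two
    nlinarith [hω x]
  have h2 : ω c - 30 + (ω c' - 30) ≤ ∑ x ∈ D, ∑ y ∈ E.toFinset,
      (if K.Adj x y then ω x - 30 else 0) := by
    have key : ∀ x ∈ D, (if x = c then ω c - 30 else 0) + (if x = c' then ω c' - 30 else 0) ≤
        ∑ y ∈ E.toFinset, (if K.Adj x y then ω x - 30 else 0) := by
      intro x hx
      by_cases h₁ : x = c
      · subst h₁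
        have := le_sum_ite_of_subset (D := E.toFinset) (p := K.Adj x) (c := ω x - 30)
          (by linarith [hω x]) {E.head hEne} fun y hy hxy => by
            rcases hends y (List.mem_toFinset.1 hy) x hx hxy.symm with h | h
            · rw [List.head?_eq_some_head hEne] at h
              simpa using h.2.symm
            · exact (hcc' h.1).elim
        simp only [if_true, if_neg hcc']
        simpa using this
      · by_cases h₂ : x = c'
        · subst h₂
          have := le_sum_ite_of_subset (D := E.toFinset) (p := K.Adj x) (c := ω x - 30)
            (by linarith [hω x]) {E.getLast hEne} fun y hy hxy => by
              rcases hends y (List.mem_toFinset.1 hy) x hx hxy.symm with h | h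
              · exact (h₁ h.1).elim
              · rw [List.getLast?_eq_some_getLast hEne] at h
                simpa using h.2.symm
          simp only [if_true, if_neg h₁]
          simpa using this
        · rw [if_neg h₁, if_neg h₂]
          refine (Finset.sum_eq_zero fun y hy => if_neg fun hxy => ?_).ge.trans' (by simp)
          rcases hends y (List.mem_toFinset.1 hy) x hx hxy.symm with h | h
          exacts [h₁ h.1, h₂ h.1]
    refine le_trans (le_of_eq ?_) (Finset.sum_le_sum key)
    rw [Finset.sum_add_distrib, Finset.sum_ite_eq', Finset.sum_ite_eq', if_pos hcD, if_pos hcD']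
  rw [Finset.sum_sub_distrib, ← Finset.mul_sum, List.sum_toFinset _ hEnd, Finset.sum_const,
    List.toFinset_card_of_nodup hEnd] at h1
  rw [potential, potential, sum_sum_union hdisj, Finset.card_union_of_disjoint hdisj,
    List.toFinset_card_of_nodup hEnd]
  simp only [List.map_append, List.map_cons, List.sum_append, List.sum_cons, List.map_reverse,
    List.sum_reverse, nsmul_eq_mul] at hf h1 ⊢
  push_cast
  linarith

end Potential

section Disc

variable {V : Type*} {K : SimpleGraph V} {ω : V → ℤ} {D O H : Finset V} {C E : List V} {c c' : V}

lemma segment_adj {p q : V} {A : List V} (h : (p :: (A ++ [q])).IsChain K.Adj) :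
    SetConn K {y | y ∈ p :: A} ∧ ∃ x ∈ p :: A, K.Adj x q := by
  rw [← List.cons_append, List.isChain_append] at h
  refine ⟨SetConn.of_isChain h.1, (p :: A).getLast (by simp), List.getLast_mem _, ?_⟩
  exact h.2.2 _ (List.getLast?_eq_some_getLast _) _ (by simp)

lemma nodup_disjoint_three {P₁ P₂ P₃ : List V} (h : (P₁ ++ (P₂ ++ P₃)).Nodup) :
    Disjoint {y | y ∈ P₁} {y | y ∈ P₂} ∧ Disjoint {y | y ∈ P₁} {y | y ∈ P₃} ∧
      Disjoint {y | y ∈ P₂} {y | y ∈ P₃} := by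
  simp only [List.nodup_append, List.mem_append] at h
  simp only [Set.disjoint_left, Set.mem_ofPred_eq]
  grind

lemma nodup_disjoint_four {P₁ P₂ P₃ P₄ : List V} (h : (P₁ ++ (P₂ ++ (P₃ ++ P₄))).Nodup) :
    Disjoint {y | y ∈ P₁} {y | y ∈ P₂} ∧ Disjoint {y | y ∈ P₁} {y | y ∈ P₃} ∧
      Disjoint {y | y ∈ P₁} {y | y ∈ P₄} ∧ Disjoint {y | y ∈ P₂} {y | y ∈ P₃} ∧
      Disjoint {y | y ∈ P₂} {y | y ∈ P₄} ∧ Disjoint {y | y ∈ P₃} {y | y ∈ P₄} := by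
  simp only [List.nodup_append, List.mem_append] at h
  simp only [Set.disjoint_left, Set.mem_ofPred_eq]
  grind

lemma IsGoodEar.reverse (h : IsGoodEar K O H E c c') : IsGoodEar K O H E.reverse c' c where
  nodup := List.nodup_reverse.2 h.nodup
  chain := isChain_reverse_iff.2 h.chain
  mem := fun x hx => h.mem x (List.mem_reverse.1 hx)
  sub := h.sub
  conn := h.conn
  left_notMem := h.right_notMem
  right_notMem := h.left_notMem
  ne := h.ne.symm
  head := by simpa using h.last
  last := by simpa using h.head
  cover := by simpa using h.cover
  simple := by
    rcases h.simple with ⟨v, rfl⟩ | ⟨h1, h2⟩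
    · exact Or.inl ⟨v, rfl⟩
    · refine Or.inr ⟨by simpa using h1, fun x hx y hy hxy => ?_⟩
      have := h2 x (List.mem_reverse.1 hx) y hy hxy
      simpa [or_comm] using this

lemma IsGoodEar.realign {c₀ c₀' : V} (h : IsGoodEar K O H E c₀ c₀') (hc : c ∉ O) (hc' : c' ∉ O)
    (hne : c ≠ c') (hM : ∃ x ∈ E, K.Adj x c) (hM' : ∃ x ∈ E, K.Adj x c') :
    ∃ E', IsGoodEar K O H E' c c' := by
  obtain ⟨x, hx, hxc⟩ := hM
  obtain ⟨x', hx', hxc'⟩ := hM'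
  rcases h.simple with ⟨v, rfl⟩ | ⟨h1, h2⟩
  · rw [List.mem_singleton] at hx hx'
    subst hx hx'
    exact ⟨[x'], { h with
      left_notMem := hc
      right_notMem := hc'
      ne := hne
      head := ⟨x', rfl, hxc⟩
      last := ⟨x', rfl, hxc'⟩
      simple := Or.inl ⟨x', rfl⟩ }⟩
  · rcases h2 x hx c hc hxc with ⟨rfl, -⟩ | ⟨rfl, -⟩ <;>
      rcases h2 x' hx' c' hc' hxc' with ⟨rfl, -⟩ | ⟨rfl, -⟩
    exacts [(hne rfl).elim, ⟨E, h⟩, ⟨E.reverse, h.reverse⟩, (hne rfl).elim]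

/-- `C` bounds a partially explored disc with explored vertices `D` and unexplored ones `O`. -/
structure DiscState (K : SimpleGraph V) (D O : Finset V) (C : List V) : Prop where
  nodup : C.Nodup
  cyc : Cycle.Chain K.Adj (C : Cycle V)
  sub : ∀ x ∈ C, x ∈ D
  disj : ∀ x ∈ D, x ∉ O
  nbrs : ∀ x ∈ O, ∀ y, K.Adj x y → y ∈ O ∨ y ∈ C
  conn : O = ∅ ∨ SetConn K (O : Set V)

lemma DiscState.of_isRotated {C' : List V} (h : DiscState K D O C) (hr : C ~r C') :
    DiscState K D O C' where
  nodup := hr.nodup_iff.1 h.nodup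
  cyc := Cycle.coe_eq_coe.2 hr ▸ h.cyc
  sub := fun x hx => h.sub x (hr.mem_iff.2 hx)
  disj := h.disj
  nbrs := fun x hx y hxy => (h.nbrs x hx y hxy).imp_right hr.mem_iff.1
  conn := h.conn

lemma DiscState.hasMinor_K33 {A₁ A₂ A₃ A₄ : List V} {s s' c₀ c₀' : V}
    (h : DiscState K D O (c :: (A₁ ++ s :: (A₂ ++ c' :: (A₃ ++ s' :: A₄)))))
    (hO : SetConn K (O : Set V))
    (hE : IsGoodEar K O H E c₀ c₀') (hc : ∃ x ∈ E, K.Adj x c) (hc' : ∃ x ∈ E, K.Adj x c')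
    (hs : ∃ x ∈ H, K.Adj x s) (hs' : ∃ x ∈ H, K.Adj x s') :
    HasMinor K (completeBipartiteGraph (Fin 3) (Fin 3)) := by
  obtain ⟨k₁, r₁⟩ := cycle_chain_append_iff.1 h.cyc
  have e₁ : s :: (A₂ ++ c' :: (A₃ ++ s' :: A₄) ++ [c]) =
    (s :: A₂) ++ c' :: (A₃ ++ s' :: A₄ ++ [c]) := by simp
  rw [e₁] at r₁
  obtain ⟨k₂, r₂⟩ := List.isChain_split.1 r₁
  have e₂ : c' :: (A₃ ++ s' :: A₄ ++ [c]) = (c' :: A₃) ++ s' :: (A₄ ++ [c]) := by simp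
  rw [e₂] at r₂
  obtain ⟨k₃, k₄⟩ := List.isChain_split.1 r₂
  obtain ⟨q₁, x₁, hx₁, a₁⟩ := segment_adj k₁
  obtain ⟨q₂, x₂, hx₂, a₂⟩ := segment_adj k₂
  obtain ⟨q₃, x₃, hx₃, a₃⟩ := segment_adj k₃
  obtain ⟨q₄, x₄, hx₄, a₄⟩ := segment_adj k₄
  have hnd : ((c :: A₁) ++ ((s :: A₂) ++ ((c' :: A₃) ++ (s' :: A₄)))).Nodup := by
    simpa using h.nodup
  have hCO : ∀ x ∈ (c :: A₁) ++ ((s :: A₂) ++ ((c' :: A₃) ++ (s' :: A₄))), x ∉ O := fun x hx =>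
    h.disj x (h.sub x (by simpa using hx))
  have hm₁ : c ∈ c :: A₁ := List.mem_cons_self
  have hm₂ : s ∈ s :: A₂ := List.mem_cons_self
  have hm₃ : c' ∈ c' :: A₃ := List.mem_cons_self
  have hm₄ : s' ∈ s' :: A₄ := List.mem_cons_self
  clear h e₁ e₂ r₁ r₂ k₁ k₂ k₃ k₄
  generalize c :: A₁ = P₁ at *
  generalize s :: A₂ = P₂ at *
  generalize c' :: A₃ = P₃ at *
  generalize s' :: A₄ = P₄ at *
  obtain ⟨d₁, d₂, d₃, d₄, d₅, d₆⟩ := nodup_disjoint_four hnd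
  obtain ⟨u, hu, hus⟩ := hs
  obtain ⟨u', hu', hus'⟩ := hs'
  obtain ⟨w, hw, hwc⟩ := hc
  obtain ⟨w', hw', hwc'⟩ := hc'
  have hHne : H ≠ ∅ := Finset.ne_empty_of_mem hu
  have hHc := hE.conn.resolve_left hHne
  have hEH : ∃ x ∈ H, ∃ y ∈ E, K.Adj x y := by
    obtain ⟨x, hxO, y, hyO, hx, hy, hxy⟩ := hO.exists_boundary_adj (T := (H : Set V))
      (hE.sub hu) hu (hE.mem w hw).1 (hE.mem w hw).2
    exact ⟨x, hx, y, (hE.cover y hyO).resolve_left hy, hxy⟩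
  obtain ⟨z, hz, t, ht, hzt⟩ := hEH
  have dE : ∀ P : List V, (∀ x ∈ P, x ∉ O) → Disjoint {y | y ∈ P} {y | y ∈ E} := fun P hP => by
    rw [Set.disjoint_left]
    exact fun x hx hx' => hP x hx (hE.mem x hx').1
  have dH : ∀ P : List V, (∀ x ∈ P, x ∉ O) → Disjoint {y | y ∈ P} (H : Set V) := fun P hP => by
    rw [Set.disjoint_left]
    exact fun x hx hx' => hP x hx (hE.sub hx')
  have dEH : Disjoint {y | y ∈ E} (H : Set V) := by
    rw [Set.disjoint_left]
    exact fun x hx hx' => (hE.mem x hx).2 hx'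
  have o₁ : ∀ x ∈ P₁, x ∉ O := fun x hx => hCO x (by simp [hx])
  have o₂ : ∀ x ∈ P₂, x ∉ O := fun x hx => hCO x (by simp [hx])
  have o₃ : ∀ x ∈ P₃, x ∉ O := fun x hx => hCO x (by simp [hx])
  have o₄ : ∀ x ∈ P₄, x ∉ O := fun x hx => hCO x (by simp [hx])
  refine _root_.hasMinor_K33 (A₁ := {y | y ∈ P₁}) (A₂ := {y | y ∈ P₃}) (A₃ := (H : Set V))
    (B₁ := {y | y ∈ P₂}) (B₂ := {y | y ∈ P₄}) (B₃ := {y | y ∈ E}) ?_ ?_ ?_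
  · simp only [List.pairwise_cons, List.mem_cons, List.not_mem_nil, or_false, forall_eq_or_imp,
      forall_eq]
    exact ⟨⟨d₂, dH _ o₁, d₁, d₃, dE _ o₁⟩, ⟨dH _ o₃, d₄.symm, d₆, dE _ o₃⟩,
      ⟨(dH _ o₂).symm, (dH _ o₄).symm, dEH.symm⟩, ⟨d₅, dE _ o₂⟩, dE _ o₄, by simp⟩
  · simp only [List.mem_cons, List.not_mem_nil, or_false, forall_eq_or_imp, forall_eq]
    exact ⟨q₁, q₃, hHc, q₂, q₄, SetConn.of_isChain' hE.chain hE.ne_nil⟩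
  · simp only [List.mem_cons, List.not_mem_nil, or_false, forall_eq_or_imp, forall_eq]
    exact ⟨⟨⟨x₁, hx₁, s, hm₂, a₁⟩, ⟨c, hm₁, x₄, hx₄, a₄.symm⟩, c, hm₁, w, hw, hwc.symm⟩,
      ⟨⟨c', hm₃, x₂, hx₂, a₂.symm⟩, ⟨x₃, hx₃, s', hm₄, a₃⟩, c', hm₃, w', hw', hwc'.symm⟩,
      ⟨u, hu, s, hm₂, hus⟩, ⟨u', hu', s', hm₄, hus'⟩, z, hz, t, ht, hzt⟩

lemma DiscState.hasMinor_K5 {A₁ A₂ A₃ : List V} {c₁ c₂ c₃ c₀ c₀' : V}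
    (h : DiscState K D O (c₁ :: (A₁ ++ c₂ :: (A₂ ++ c₃ :: A₃))))
    (hO : SetConn K (O : Set V)) (hE : IsGoodEar K O H E c₀ c₀')
    (hM : ∀ c, c = c₁ ∨ c = c₂ ∨ c = c₃ → ∃ x ∈ E, K.Adj x c)
    (hN : ∀ c, c = c₁ ∨ c = c₂ ∨ c = c₃ → ∃ x ∈ H, K.Adj x c) :
    HasMinor K (completeGraph (Fin 5)) := by
  obtain ⟨k₁, r₁⟩ := cycle_chain_append_iff.1 h.cyc
  have e₁ : c₂ :: (A₂ ++ c₃ :: A₃ ++ [c₁]) = (c₂ :: A₂) ++ c₃ :: (A₃ ++ [c₁]) := by simp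
  rw [e₁] at r₁
  obtain ⟨k₂, k₃⟩ := List.isChain_split.1 r₁
  obtain ⟨q₁, x₁, hx₁, a₁⟩ := segment_adj k₁
  obtain ⟨q₂, x₂, hx₂, a₂⟩ := segment_adj k₂
  obtain ⟨q₃, x₃, hx₃, a₃⟩ := segment_adj k₃
  have hnd : ((c₁ :: A₁) ++ ((c₂ :: A₂) ++ (c₃ :: A₃))).Nodup := by simpa using h.nodup
  have hCO : ∀ x ∈ (c₁ :: A₁) ++ ((c₂ :: A₂) ++ (c₃ :: A₃)), x ∉ O := fun x hx =>
    h.disj x (h.sub x (by simpa using hx))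
  have hm₁ : c₁ ∈ c₁ :: A₁ := List.mem_cons_self
  have hm₂ : c₂ ∈ c₂ :: A₂ := List.mem_cons_self
  have hm₃ : c₃ ∈ c₃ :: A₃ := List.mem_cons_self
  clear h e₁ r₁ k₁ k₂ k₃
  generalize c₁ :: A₁ = P₁ at *
  generalize c₂ :: A₂ = P₂ at *
  generalize c₃ :: A₃ = P₃ at *
  obtain ⟨d₁, d₂, d₃⟩ := nodup_disjoint_three hnd
  obtain ⟨w₁, hw₁, b₁⟩ := hM c₁ (by simp)
  obtain ⟨w₂, hw₂, b₂⟩ := hM c₂ (by simp)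
  obtain ⟨w₃, hw₃, b₃⟩ := hM c₃ (by simp)
  obtain ⟨u₁, hu₁, f₁⟩ := hN c₁ (by simp)
  obtain ⟨u₂, hu₂, f₂⟩ := hN c₂ (by simp)
  obtain ⟨u₃, hu₃, f₃⟩ := hN c₃ (by simp)
  have hHc := hE.conn.resolve_left (Finset.ne_empty_of_mem hu₁)
  have hEH : ∃ x ∈ H, ∃ y ∈ E, K.Adj x y := by
    obtain ⟨x, hxO, y, hyO, hx, hy, hxy⟩ := hO.exists_boundary_adj (T := (H : Set V))
      (hE.sub hu₁) hu₁ (hE.mem w₁ hw₁).1 (hE.mem w₁ hw₁).2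
    exact ⟨x, hx, y, (hE.cover y hyO).resolve_left hy, hxy⟩
  obtain ⟨z, hz, t, ht, hzt⟩ := hEH
  have dE : ∀ P : List V, (∀ x ∈ P, x ∉ O) → Disjoint {y | y ∈ P} {y | y ∈ E} := fun P hP => by
    rw [Set.disjoint_left]
    exact fun x hx hx' => hP x hx (hE.mem x hx').1
  have dH : ∀ P : List V, (∀ x ∈ P, x ∉ O) → Disjoint {y | y ∈ P} (H : Set V) := fun P hP => by
    rw [Set.disjoint_left]
    exact fun x hx hx' => hP x hx (hE.sub hx')
  have dEH : Disjoint {y | y ∈ E} (H : Set V) := by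
    rw [Set.disjoint_left]
    exact fun x hx hx' => (hE.mem x hx).2 hx'
  have o₁ : ∀ x ∈ P₁, x ∉ O := fun x hx => hCO x (by simp [hx])
  have o₂ : ∀ x ∈ P₂, x ∉ O := fun x hx => hCO x (by simp [hx])
  have o₃ : ∀ x ∈ P₃, x ∉ O := fun x hx => hCO x (by simp [hx])
  have qE := SetConn.of_isChain' hE.chain hE.ne_nil
  refine _root_.hasMinor_K5 (A := ![{y | y ∈ P₁}, {y | y ∈ P₂}, {y | y ∈ P₃}, {y | y ∈ E}, H])
    ?_ ?_ ?_
  · intro i j hij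
    fin_cases i <;> fin_cases j <;> first | exact absurd hij (by decide) | skip
    exacts [d₁, d₂, dE _ o₁, dH _ o₁, d₃, dE _ o₂, dH _ o₂, dE _ o₃, dH _ o₃, dEH]
  · intro i
    fin_cases i
    exacts [q₁, q₂, q₃, qE, hHc]
  · intro i j hij
    fin_cases i <;> fin_cases j <;> first | exact absurd hij (by decide) | skip
    exacts [⟨x₁, hx₁, c₂, hm₂, a₁⟩, ⟨c₁, hm₁, x₃, hx₃, a₃.symm⟩, ⟨c₁, hm₁, w₁, hw₁, b₁.symm⟩,
      ⟨c₁, hm₁, u₁, hu₁, f₁.symm⟩, ⟨x₂, hx₂, c₃, hm₃, a₂⟩, ⟨c₂, hm₂, w₂, hw₂, b₂.symm⟩,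
      ⟨c₂, hm₂, u₂, hu₂, f₂.symm⟩, ⟨c₃, hm₃, w₃, hw₃, b₃.symm⟩, ⟨c₃, hm₃, u₃, hu₃, f₃.symm⟩,
      ⟨t, ht, z, hz, hzt.symm⟩]

open Classical in
lemma DiscState.attach_ear {S S' : List V} (h : DiscState K D O (c :: (S ++ c' :: S')))
    (hE : IsGoodEar K O H E c c') (hS : ∀ x ∈ S, ¬ ∃ u ∈ H, K.Adj u x) :
    DiscState K (D ∪ E.toFinset) H (c :: (E ++ c' :: S')) := by
  have hED : ∀ x ∈ E, x ∉ D := fun x hx hxD => h.disj x hxD (hE.mem x hx).1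
  have hsub : (c :: c' :: S').Sublist (c :: (S ++ c' :: S')) :=
    List.Sublist.cons_cons _ (List.sublist_append_right _ _)
  refine ⟨?_, ?_, ?_, ?_, ?_, hE.conn⟩
  · have hp : (c :: (E ++ c' :: S')).Perm (E ++ (c :: c' :: S')) :=
      (List.perm_middle (l₁ := E) (a := c) (l₂ := c' :: S')).symm
    rw [hp.nodup_iff, List.nodup_append]
    exact ⟨hE.nodup, h.nodup.sublist hsub,
      fun x hx y hy hxy => hED x hx (hxy ▸ h.sub y (hsub.subset hy))⟩
  · exact cycle_chain_append_iff.2 ⟨isChain_ear hE.chain hE.head hE.last,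
      (cycle_chain_append_iff.1 h.cyc).2⟩
  · intro x hx
    rw [Finset.mem_union, List.mem_toFinset]
    by_cases hxE : x ∈ E
    · exact Or.inr hxE
    · left
      refine h.sub x (hsub.subset ?_)
      simp only [List.mem_cons, List.mem_append] at hx ⊢
      tauto
  · intro x hx hxH
    rcases Finset.mem_union.1 hx with hx | hx
    · exact h.disj x hx (hE.sub hxH)
    · exact (hE.mem x (List.mem_toFinset.1 hx)).2 hxH
  · intro x hx y hxy
    rcases h.nbrs x (hE.sub hx) y hxy with hy | hy
    · rcases hE.cover y hy with hy | hy
      · exact Or.inl hy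
      · exact Or.inr (by simp [hy])
    · right
      have := fun hyS => hS y hyS ⟨x, hx, hxy⟩
      simp only [List.mem_cons, List.mem_append] at hy ⊢
      tauto

open Classical in
lemma DiscState.step (h : DiscState K D O C) (hO : SetConn K (O : Set V))
    (h3 : ∀ Y : Set V, Y ⊆ O → Y ≠ O → Y.Nonempty → ∃ d₁ d₂ d₃, d₁ ≠ d₂ ∧ d₁ ≠ d₃ ∧ d₂ ≠ d₃ ∧
      ∀ d, d = d₁ ∨ d = d₂ ∨ d = d₃ → d ∉ Y ∧ ∃ y ∈ Y, K.Adj y d)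
    (h2 : ∃ d d', d ≠ d' ∧ d ∉ O ∧ d' ∉ O ∧ (∃ x ∈ O, K.Adj x d) ∧ ∃ x ∈ O, K.Adj x d')
    (hK33 : ¬ HasMinor K (completeBipartiteGraph (Fin 3) (Fin 3)))
    (hK5 : ¬ HasMinor K (completeGraph (Fin 5)))
    (hface : ∀ l : List V, 3 ≤ l.length → l.Nodup →
      Cycle.Chain K.Adj (l : Cycle V) → 60 ≤ (l.map ω).sum) (hω : ∀ x, ω x ≤ 30) :
    ∃ D' O' C', DiscState K D' O' C' ∧ O' ⊂ O ∧ D' ∪ O' = D ∪ O ∧ 3 ≤ C'.length ∧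
      potential K ω D C ≤ potential K ω D' C' := by
  obtain ⟨H, E₀, c₀, c₀', hE₀⟩ := exists_isGoodEar hO h3 h2
  have hmemC : ∀ x ∈ E₀, ∀ y, y ∉ O → K.Adj x y → y ∈ C := fun x hx y hy hxy =>
    (h.nbrs x (hE₀.mem x hx).1 y hxy).resolve_left hy
  obtain ⟨x, hx, hxc⟩ := hE₀.head
  obtain ⟨x', hx', hxc'⟩ := hE₀.last
  have hx := List.mem_of_head? hx
  have hx' := List.mem_of_getLast? hx'
  rcases List.cyclic_trichotomy (C := C) (M := fun y => ∃ x ∈ E₀, K.Adj x y)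
    (N := fun y => ∃ x ∈ H, K.Adj x y)
    ⟨c₀, hmemC x hx _ hE₀.left_notMem hxc, c₀', hmemC x' hx' _ hE₀.right_notMem hxc', hE₀.ne,
      ⟨x, hx, hxc⟩, x', hx', hxc'⟩ with
    ⟨c, S, c', S', hrot, hMc, hMc', hS', hS⟩ | ⟨c, A₁, s, A₂, c', A₃, s', A₄, hrot, k₁, k₂, k₃, k₄⟩ |
    ⟨c₁, A₁, c₂, A₂, c₃, A₃, hrot, k₁, k₂, k₃, k₄, k₅, k₆⟩
  · have h' := h.of_isRotated hrot
    have hc : c ∈ D := h'.sub c (by simp)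
    have hc' : c' ∈ D := h'.sub c' (by simp)
    have hne : c ≠ c' := by
      rintro rfl
      simpa using h'.nodup
    obtain ⟨E, hE⟩ := hE₀.realign (h.disj c hc) (h.disj c' hc') hne hMc hMc'
    have hEE₀ : ∀ x ∈ E, x ∈ E₀ := fun x hx =>
      (hE₀.cover x (hE.mem x hx).1).resolve_left (hE.mem x hx).2
    have hED : ∀ x ∈ E, x ∉ D := fun x hx hxD => h.disj x hxD (hE.mem x hx).1
    refine ⟨_, _, _, h'.attach_ear hE hS, ?_, ?_, ?_, ?_⟩
    · obtain ⟨y, hy, -⟩ := hE.head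
      have hy := hE.mem y (List.mem_of_head? hy)
      exact Finset.ssubset_iff_of_subset hE.sub |>.2 ⟨y, hy⟩
    · rw [Finset.union_assoc]
      congr 1
      ext x
      rw [Finset.mem_union, List.mem_toFinset]
      constructor
      · rintro (hx | hx)
        exacts [(hE.mem x hx).1, hE.sub hx]
      · exact fun hx => (hE.cover x hx).symm
    · have := List.length_pos_of_ne_nil hE.ne_nil
      simp only [List.length_cons, List.length_append]
      omega
    · rw [potential_of_isRotated hrot]
      rcases hE.simple with ⟨v, rfl⟩ | ⟨hd, he⟩
      · have hvE : v ∈ [v] := List.mem_singleton_self v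
        obtain ⟨y, hy, hyc⟩ := hE.head
        obtain ⟨y', hy', hyc'⟩ := hE.last
        simp only [List.head?_cons, List.getLast?_singleton, Option.some.injEq] at hy hy'
        subst hy hy'
        refine potential_single hface h'.cyc h'.nodup h'.sub (hED v hvE) hyc hyc' fun x hx hvx => ?_
        have hxC := (h'.nbrs v (hE.mem v hvE).1 x hvx).resolve_left (h.disj x hx)
        have := fun hxS' => hS' x hxS' ⟨v, hEE₀ v hvE, hvx⟩
        simp only [List.mem_cons, List.mem_append] at hxC
        tauto
      · refine potential_path hface h'.cyc h'.nodup h'.sub hω hED hE.nodup hE.ne_nil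
          (isChain_ear hE.chain hE.head hE.last) (fun x hx => ?_)
          fun x hx y hy => he x hx y (h.disj y hy)
        obtain ⟨u, w, huw⟩ := hd x hx
        exact ⟨u, w, fun y hxy hy => huw y hxy (hy.imp_right (h.disj y))⟩
  · exact (hK33 ((h.of_isRotated hrot).hasMinor_K33 hO hE₀ k₁ k₂ k₃ k₄)).elim
  · refine (hK5 ((h.of_isRotated hrot).hasMinor_K5 hO hE₀ ?_ ?_)).elim
    · rintro c (rfl | rfl | rfl)
      exacts [k₁, k₂, k₃]
    · rintro c (rfl | rfl | rfl)
      exacts [k₄, k₅, k₆]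

open Classical in
lemma DiscState.exists_final {O₀ : Finset V}
    (h3 : ∀ Y : Set V, Y ⊆ O₀ → Y ≠ O₀ → Y.Nonempty → ∃ d₁ d₂ d₃, d₁ ≠ d₂ ∧ d₁ ≠ d₃ ∧ d₂ ≠ d₃ ∧
      ∀ d, d = d₁ ∨ d = d₂ ∨ d = d₃ → d ∉ Y ∧ ∃ y ∈ Y, K.Adj y d)
    (h2 : ∃ d d', d ≠ d' ∧ d ∉ O₀ ∧ d' ∉ O₀ ∧ (∃ x ∈ O₀, K.Adj x d) ∧ ∃ x ∈ O₀, K.Adj x d')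
    (hK33 : ¬ HasMinor K (completeBipartiteGraph (Fin 3) (Fin 3)))
    (hK5 : ¬ HasMinor K (completeGraph (Fin 5)))
    (hface : ∀ l : List V, 3 ≤ l.length → l.Nodup →
      Cycle.Chain K.Adj (l : Cycle V) → 60 ≤ (l.map ω).sum) (hω : ∀ x, ω x ≤ 30) :
    ∀ (n : ℕ) (D O : Finset V) (C : List V), O.card = n → DiscState K D O C → O ⊆ O₀ →
      O = ∅ ∧ 3 ≤ C.length ∨ O.Nonempty →
      ∃ C', DiscState K (D ∪ O) ∅ C' ∧ 3 ≤ C'.length ∧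
        potential K ω D C ≤ potential K ω (D ∪ O) C' := by
  intro n
  induction n using Nat.strong_induction_on with
  | _ n ih =>
    rintro D O C hn h hOO₀ (⟨rfl, hC⟩ | hne)
    · exact ⟨C, by simpa using h, hC, by simp⟩
    have hO := h.conn.resolve_left hne.ne_empty
    obtain ⟨D', O', C', h', hlt, hDO, hC', hpot⟩ := h.step (ω := ω) hO
      (fun Y hY hYO hYne => h3 Y (hY.trans (Finset.coe_subset.2 hOO₀)) (by
        rintro rfl
        exact hYO (hY.antisymm (Finset.coe_subset.2 hOO₀))) hYne)
      (by
        by_cases e : O = O₀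
        · rw [e]; exact h2
        · obtain ⟨d₁, d₂, d₃, n₁, -, -, hd⟩ := h3 O (Finset.coe_subset.2 hOO₀)
            (fun e' => e (Finset.coe_injective e')) hne
          exact ⟨d₁, d₂, n₁, (hd d₁ (by simp)).1, (hd d₂ (by simp)).1, (hd d₁ (by simp)).2,
            (hd d₂ (by simp)).2⟩)
      hK33 hK5 hface hω
    obtain ⟨C'', h'', hC'', hpot'⟩ := ih O'.card (hn ▸ Finset.card_lt_card hlt) D' O' C' rfl h'
      (hlt.1.trans hOO₀) (O'.eq_empty_or_nonempty.imp (fun e => ⟨e, hC'⟩) id)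
    rw [hDO] at h'' hpot'
    exact ⟨C'', h'', hC'', hpot.trans hpot'⟩

end Disc

section Pentagon

variable {V : Type*} [Fintype V] {G : SimpleGraph V}

lemma exists_minimal_isFragment {a₀ b₀ : V}
    (hdeg : ∀ v w, G.Adj v w → ∀ r s, ∃ u, G.Adj v u ∧ u ≠ r ∧ u ≠ s) (hab : G.Adj a₀ b₀) :
    ∃ a b O, IsFragment G a b O ∧ ∀ a' b' O', IsFragment G a' b' O' → O.card ≤ O'.card := by
  obtain ⟨O₀, hO₀⟩ := exists_isFragment hdeg hab
  obtain ⟨⟨a, b, O⟩, h, hmin⟩ := (InvImage.wf (fun q : V × V × Finset V => q.2.2.card)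
    wellFounded_lt).has_min {q | IsFragment G q.1 q.2.1 q.2.2} ⟨(a₀, b₀, O₀), hO₀⟩
  exact ⟨a, b, O, h, fun a' b' O' h' => not_lt.1 (hmin (a', b', O') h')⟩

open Classical in
/-- The charge of a vertex of a fragment with interior `O`. -/
noncomputable def charge (G : SimpleGraph V) (O : Finset V) (x : V) : ℤ :=
  if x ∈ O then if G.degree x = 3 then 10 else 15 else 25

open Classical in
lemma charge_cases (G : SimpleGraph V) (O : Finset V) (x : V) :
    (charge G O x = 10 ∧ G.degree x = 3) ∨ 15 ≤ charge G O x ∧ charge G O x ≤ 25 := by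
  rw [charge]
  split_ifs with h1 h2
  · exact Or.inl ⟨rfl, h2⟩
  · right; norm_num
  · right; norm_num

lemma ten_le_charge (G : SimpleGraph V) (O : Finset V) (x : V) : 10 ≤ charge G O x := by
  rcases charge_cases G O x with h | h <;> linarith [h.1]

lemma charge_le (G : SimpleGraph V) (O : Finset V) (x : V) : charge G O x ≤ 25 := by
  rcases charge_cases G O x with h | h
  · linarith [h.1]
  · exact h.2

lemma charge_of_notMem {O : Finset V} {x : V} (hx : x ∉ O) : charge G O x = 25 := by
  rw [charge, if_neg hx]

lemma ten_mul_length_le_sum_charge (O : Finset V) (l : List V) :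
    10 * (l.length : ℤ) ≤ (l.map (charge G O)).sum := by
  induction l with
  | nil => simp
  | cons x l ih =>
    simp only [List.length_cons, List.map_cons, List.sum_cons]
    push_cast
    linarith [ten_le_charge G O x]

variable (htri : ∀ x y z, G.Adj x y → G.Adj y z → G.Adj z x → False)
  (hsq : ∀ x y z w, G.Adj x y → G.Adj y z → G.Adj z w → G.Adj w x → x ≠ z → y ≠ w → False)

include htri hsq

open Classical in
lemma sixty_le_sum_charge {O : Finset V} {a b : V} (ha : a ∉ O) (hb : b ∉ O)
    (hpent : ∀ x₀ x₁ x₂ x₃ x₄, [x₀, x₁, x₂, x₃, x₄].Nodup → G.Adj x₀ x₁ → G.Adj x₁ x₂ →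
      G.Adj x₂ x₃ → G.Adj x₃ x₄ → G.Adj x₄ x₀ → ¬ (G.degree x₀ = 3 ∧ G.degree x₂ = 3))
    (l : List V) (hl : 3 ≤ l.length) (hnd : l.Nodup)
    (hch : Cycle.Chain (torso G O a b).Adj (l : Cycle V)) : 60 ≤ (l.map (charge G O)).sum := by
  by_cases hout : ∃ p ∈ l, ∃ q ∈ l, p ≠ q ∧ p ∉ O ∧ q ∉ O
  · obtain ⟨p, hp, q, hq, hpq, hpO, hqO⟩ := hout
    have h1 := List.perm_cons_erase hp
    have hq' : q ∈ l.erase p := (List.mem_erase_of_ne hpq.symm).2 hq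
    have h2 := List.perm_cons_erase hq'
    rw [(h1.map _).sum_eq, List.map_cons, List.sum_cons, (h2.map _).sum_eq, List.map_cons,
      List.sum_cons, charge_of_notMem hpO, charge_of_notMem hqO]
    have h3 := ten_mul_length_le_sum_charge (G := G) O ((l.erase p).erase q)
    have h4 : 1 ≤ ((l.erase p).erase q).length := by
      have := h1.length_eq
      have := h2.length_eq
      simp only [List.length_cons] at *
      omega
    have h5 : (1 : ℤ) ≤ ((l.erase p).erase q).length := by exact_mod_cast h4
    linarith
  · push Not at hout
    have hadj : ∀ x ∈ l, ∀ y ∈ l, (torso G O a b).Adj x y → G.Adj x y := by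
      intro x hx y hy hxy
      rcases hxy.2 with h | ⟨rfl, rfl⟩ | ⟨rfl, rfl⟩
      exacts [h.1, (hb (hout _ hx _ hy hxy.1 ha)).elim, (ha (hout _ hx _ hy hxy.1 hb)).elim]
    by_cases h6 : 6 ≤ l.length
    · have h1 := ten_mul_length_le_sum_charge (G := G) O l
      have h2 : (6 : ℤ) ≤ l.length := by exact_mod_cast h6
      linarith
    match l, hl, h6 with
    | [x, y, z], _, _ =>
      simp only [Cycle.chain_coe_cons, List.cons_append, List.nil_append,
        List.isChain_cons_cons] at hch
      exact (htri x y z (hadj x (by simp) y (by simp) hch.1)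
        (hadj y (by simp) z (by simp) hch.2.1) (hadj z (by simp) x (by simp) hch.2.2.1)).elim
    | [x, y, z, w], _, _ =>
      simp only [Cycle.chain_coe_cons, List.cons_append, List.nil_append,
        List.isChain_cons_cons] at hch
      refine (hsq x y z w (hadj x (by simp) y (by simp) hch.1)
        (hadj y (by simp) z (by simp) hch.2.1) (hadj z (by simp) w (by simp) hch.2.2.1)
        (hadj w (by simp) x (by simp) hch.2.2.2.1) ?_ ?_).elim
      · rintro rfl; simp at hnd
      · rintro rfl; simp at hnd
    | [x₀, x₁, x₂, x₃, x₄], _, _ =>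
      simp only [Cycle.chain_coe_cons, List.cons_append, List.nil_append,
        List.isChain_cons_cons] at hch
      have a₀ := hadj x₀ (by simp) x₁ (by simp) hch.1
      have a₁ := hadj x₁ (by simp) x₂ (by simp) hch.2.1
      have a₂ := hadj x₂ (by simp) x₃ (by simp) hch.2.2.1
      have a₃ := hadj x₃ (by simp) x₄ (by simp) hch.2.2.2.1
      have a₄ := hadj x₄ (by simp) x₀ (by simp) hch.2.2.2.2.1
      have n₁ : [x₁, x₂, x₃, x₄, x₀].Nodup := by simpa using (List.nodup_rotate (n := 1)).2 hnd
      have n₂ : [x₂, x₃, x₄, x₀, x₁].Nodup := by simpa using (List.nodup_rotate (n := 2)).2 hnd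
      have n₃ : [x₃, x₄, x₀, x₁, x₂].Nodup := by simpa using (List.nodup_rotate (n := 3)).2 hnd
      have n₄ : [x₄, x₀, x₁, x₂, x₃].Nodup := by simpa using (List.nodup_rotate (n := 4)).2 hnd
      have pair : ∀ x y, ¬ (G.degree x = 3 ∧ G.degree y = 3) →
          25 ≤ charge G O x + charge G O y := by
        intro x y h
        have := ten_le_charge G O x
        have := ten_le_charge G O y
        rcases charge_cases G O x with h1 | h1 <;> rcases charge_cases G O y with h2 | h2
        · exact (h ⟨h1.2, h2.2⟩).elim
        all_goals linarith [h1.1, h2.1]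
      have p₀ := pair _ _ (hpent _ _ _ _ _ hnd a₀ a₁ a₂ a₃ a₄)
      have p₁ := pair _ _ (hpent _ _ _ _ _ n₁ a₁ a₂ a₃ a₄ a₀)
      have p₂ := pair _ _ (hpent _ _ _ _ _ n₂ a₂ a₃ a₄ a₀ a₁)
      have p₃ := pair _ _ (hpent _ _ _ _ _ n₃ a₃ a₄ a₀ a₁ a₂)
      have p₄ := pair _ _ (hpent _ _ _ _ _ n₄ a₄ a₀ a₁ a₂ a₃)
      simp only [List.map_cons, List.map_nil, List.sum_cons, List.sum_nil]
      linarith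
    | _ :: _ :: _ :: _ :: _ :: _ :: _, _, h6 => simp at h6

open Classical in
theorem exists_pentagon (hK33 : ¬ HasMinor G (completeBipartiteGraph (Fin 3) (Fin 3)))
    (hK5 : ¬ HasMinor G (completeGraph (Fin 5))) (hdeg : ∀ v w, G.Adj v w → 3 ≤ G.degree v)
    {a₀ b₀ : V} (hab : G.Adj a₀ b₀) :
    ∃ x₀ x₁ x₂ x₃ x₄, [x₀, x₁, x₂, x₃, x₄].Nodup ∧ G.Adj x₀ x₁ ∧ G.Adj x₁ x₂ ∧
      G.Adj x₂ x₃ ∧ G.Adj x₃ x₄ ∧ G.Adj x₄ x₀ ∧ G.degree x₀ = 3 ∧ G.degree x₂ = 3 := by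
  by_contra! hcon
  have hdeg' : ∀ v w, G.Adj v w → ∀ r s, ∃ u, G.Adj v u ∧ u ≠ r ∧ u ≠ s := by
    intro v w hvw r s
    have h1 : ({r, s} : Finset V).card < (G.neighborFinset v).card := by
      rw [G.card_neighborFinset_eq_degree]
      have := hdeg v w hvw
      have : ({r, s} : Finset V).card ≤ 2 := Finset.card_le_two
      omega
    obtain ⟨u, hu, hu'⟩ := Finset.exists_mem_notMem_of_card_lt_card h1
    simp only [Finset.mem_insert, Finset.mem_singleton, not_or] at hu'
    exact ⟨u, (G.mem_neighborFinset v u).1 hu, hu'⟩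
  obtain ⟨a, b, O, h, hmin⟩ := exists_minimal_isFragment hdeg' hab
  have hface := sixty_le_sum_charge htri hsq h.left_notMem h.right_notMem
    fun x₀ x₁ x₂ x₃ x₄ hnd h₀ h₁ h₂ h₃ h₄ h₅ => hcon x₀ x₁ x₂ x₃ x₄ hnd h₀ h₁ h₂ h₃ h₄ h₅.1 h₅.2
  have hKab : (torso G O a b).Adj a b := ⟨h.ne, Or.inr (Or.inl ⟨rfl, rfl⟩)⟩
  have hstate : DiscState (torso G O a b) {a, b} O [a, b] := by
    refine ⟨by simpa using h.ne, by simpa [Cycle.chain_coe_cons] using ⟨hKab, hKab.symm⟩,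
      by simp, ?_, ?_, Or.inr ((h.setConn hdeg' hmin).mono_graph
        fun x hx y _ hxy => torso_adj_of_mem hx hxy)⟩
    · intro x hx
      simp only [Finset.mem_insert, Finset.mem_singleton] at hx
      rcases hx with rfl | rfl
      exacts [h.left_notMem, h.right_notMem]
    · intro x hx y hxy
      have := h.nbrs x hx y ((torso_adj_iff_of_mem h.left_notMem h.right_notMem hx).1 hxy)
      simpa using this
  have h3 : ∀ Y : Set V, Y ⊆ O → Y ≠ O → Y.Nonempty → ∃ d₁ d₂ d₃, d₁ ≠ d₂ ∧ d₁ ≠ d₃ ∧ d₂ ≠ d₃ ∧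
      ∀ d, d = d₁ ∨ d = d₂ ∨ d = d₃ → d ∉ Y ∧ ∃ y ∈ Y, (torso G O a b).Adj y d := by
    intro Y hY hne hY'
    obtain ⟨d₁, d₂, d₃, n₁, n₂, n₃, hd⟩ := h.exists_three hdeg' hmin hY hne hY'
    refine ⟨d₁, d₂, d₃, n₁, n₂, n₃, fun d hd' => ?_⟩
    obtain ⟨h1, y, hy, hyd⟩ := hd d hd'
    exact ⟨h1, y, hy, torso_adj_of_mem (hY hy) hyd⟩
  obtain ⟨xa, hxa, hxa'⟩ := h.exists_adj_left hdeg' hmin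
  obtain ⟨xb, hxb, hxb'⟩ := h.exists_adj_right hdeg' hmin
  obtain ⟨C, hC, hClen, hpot⟩ := DiscState.exists_final (ω := charge G O) h3
    ⟨a, b, h.ne, h.left_notMem, h.right_notMem, ⟨xa, hxa, torso_adj_of_mem hxa hxa'⟩,
      xb, hxb, torso_adj_of_mem hxb hxb'⟩
    (fun hm => hK33 (hm.of_torso h (by
      rintro (i | i)
      · exact ⟨Sum.inr i, by simp⟩
      · exact ⟨Sum.inl i, by simp⟩)))
    (fun hm => hK5 (hm.of_torso h fun i => ⟨i + 1, by fin_cases i <;> simp⟩))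
    hface (fun x => (charge_le G O x).trans (by norm_num)) _ _ _ _ rfl hstate subset_rfl
    (Or.inr h.nonempty)
  have hCsum := hface C hClen hC.nodup hC.cyc
  have hdisj : Disjoint {a, b} O := by
    rw [Finset.disjoint_left]
    exact hstate.disj
  have hcard : (({a, b} : Finset V) ∪ O).card = 2 + O.card := by
    rw [Finset.card_union_of_disjoint hdisj, Finset.card_pair h.ne]
  have hO : ∑ x ∈ O, ∑ y ∈ {a, b} ∪ O, (if (torso G O a b).Adj x y then charge G O x - 30 else 0) ≤
      ∑ x ∈ O, (-60 : ℤ) := by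
    refine Finset.sum_le_sum fun x hx => ?_
    rw [← Finset.sum_filter, Finset.sum_const, nsmul_eq_mul]
    obtain ⟨y, hxy⟩ := h.nonisolated x hx
    have hd := hdeg x y hxy
    have h1 : G.degree x ≤ ((({a, b} : Finset V) ∪ O).filter ((torso G O a b).Adj x)).card := by
      rw [← G.card_neighborFinset_eq_degree]
      refine Finset.card_le_card fun z hz => ?_
      have hxz := (G.mem_neighborFinset x z).1 hz
      have := h.nbrs x hx z hxz
      refine Finset.mem_filter.2 ⟨?_, torso_adj_of_mem hx hxz⟩
      simp only [Finset.mem_union, Finset.mem_insert, Finset.mem_singleton]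
      tauto
    have h2 : (G.degree x : ℤ) ≤
      ((({a, b} : Finset V) ∪ O).filter ((torso G O a b).Adj x)).card := by exact_mod_cast h1
    rw [charge, if_pos hx]
    split_ifs with h3
    · rw [h3] at h2
      push_cast at h2
      linarith
    · have h4 : (4 : ℤ) ≤ G.degree x := by
        have : 4 ≤ G.degree x := by omega
        exact_mod_cast this
      linarith
  have hnonpos : ∀ x y, (if (torso G O a b).Adj x y then charge G O x - 30 else 0) ≤ 0 := by
    intro x y
    split_ifs
    · linarith [charge_le G O x]
    · rfl
  have hab' : ∑ x ∈ {a, b}, ∑ y ∈ {a, b} ∪ O,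
      (if (torso G O a b).Adj x y then charge G O x - 30 else 0) ≤ -5 := by
    rw [Finset.sum_pair h.ne]
    have h1 := Finset.sum_le_sum_of_subset_of_nonneg (s := {b}) (t := {a, b} ∪ O)
      (f := fun y => -(if (torso G O a b).Adj a y then charge G O a - 30 else 0)) (by simp)
      fun y _ _ => neg_nonneg.2 (hnonpos a y)
    have h2 : ∑ y ∈ {a, b} ∪ O, (if (torso G O a b).Adj b y then charge G O b - 30 else 0) ≤ 0 :=
      Finset.sum_nonpos fun y _ => hnonpos b y
    rw [Finset.sum_singleton, if_pos hKab, Finset.sum_neg_distrib,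
      charge_of_notMem h.left_notMem] at h1
    rw [charge_of_notMem h.left_notMem]
    linarith
  have hinit : potential (torso G O a b) (charge G O) {a, b} [a, b] = 0 := by
    rw [potential, Finset.sum_pair h.ne, Finset.sum_pair h.ne, Finset.sum_pair h.ne,
      Finset.card_pair h.ne]
    simp [hKab, hKab.symm, charge_of_notMem h.left_notMem, charge_of_notMem h.right_notMem]
  rw [hinit, potential, hcard, Finset.sum_union hdisj] at hpot
  rw [Finset.sum_const, nsmul_eq_mul] at hO
  push_cast at hpot
  linarith

end Pentagon

lemma eq_or_eq_of_two_values {V : Type*} {y t q r s : V} (hy : y ≠ r → y = s) (ht : t ≠ r → t = s)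
    (hq : q ≠ r → q = s) (h : t ≠ y) : q = y ∨ q = t := by
  by_cases hyr : y = r
  · by_cases hqr : q = r
    · exact Or.inl (hqr.trans hyr.symm)
    · exact Or.inr ((hq hqr).trans (ht fun htr => h (htr.trans hyr.symm)).symm)
  · by_cases hqr : q = r
    · refine Or.inr (hqr.trans ?_)
      by_contra htr
      exact h ((ht (Ne.symm htr)).trans (hy hyr).symm)
    · exact Or.inl ((hq hqr).trans (hy hyr).symm)

section Reduction

variable {V : Type*}

/-- Edges of weight 2 and of weight 1 dominating every edge of `K` that meets `R`. -/
structure DominatesEdges (K : SimpleGraph V) (R : Finset V) (M₂ M₁ : Finset (Sym2 V)) : Prop where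
  sub₂ : ∀ e ∈ M₂, e ∈ K.edgeSet
  sub₁ : ∀ e ∈ M₁, e ∈ K.edgeSet
  cover : ∀ x ∈ R, ∀ y, K.Adj x y → s(x, y) ∈ M₁ ∨ ∃ e ∈ M₂, x ∈ e ∨ y ∈ e
  weight : 5 * (2 * M₂.card + M₁.card) ≤ 4 * R.card

/-- Some nonempty part of `A` can be handled separately. -/
def Reducible (K : SimpleGraph V) (A : Finset V) : Prop :=
  ∃ R ⊆ A, R.Nonempty ∧ ∃ M₂ M₁, DominatesEdges K R M₂ M₁

lemma EdgeRDF.exists_of_dominatesEdges [Fintype V] [DecidableEq V] {K : SimpleGraph V}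
    {M₂ M₁ : Finset (Sym2 V)} (h : DominatesEdges K univ M₂ M₁) :
    ∃ f, EdgeRDF K f ∧ 5 * ∑ e : Sym2 V, f e ≤ 4 * Fintype.card V := by
  refine ⟨fun e => if e ∈ M₂ then 2 else if e ∈ M₁ then 1 else 0, ⟨fun e => ?_, fun e he => ?_,
    fun e he he0 => ?_⟩, ?_⟩
  · dsimp only
    split_ifs <;> omega
  · dsimp only
    rw [if_neg fun h' => he (h.sub₂ e h'), if_neg fun h' => he (h.sub₁ e h')]
  · have h2 : e ∉ M₂ := fun h' => by simp [h'] at he0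
    have h1 : e ∉ M₁ := fun h' => by simp [h', h2] at he0
    induction e using Sym2.ind with
    | _ x y =>
      rcases h.cover x (Finset.mem_univ x) y he with h' | ⟨e', he', h'⟩
      · exact (h1 h').elim
      · refine ⟨e', h.sub₂ e' he', if_pos he', fun e => h2 (e ▸ he'), ?_⟩
        rcases h' with h' | h'
        exacts [⟨x, by simp, h'⟩, ⟨y, by simp, h'⟩]
  · have key : ∀ e : Sym2 V, (if e ∈ M₂ then 2 else if e ∈ M₁ then 1 else 0) ≤
        (if e ∈ M₂ then 2 else 0) + if e ∈ M₁ then 1 else 0 := by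
      intro e
      split_ifs <;> omega
    have := Finset.sum_le_sum fun e (_ : e ∈ (univ : Finset (Sym2 V))) => key e
    rw [Finset.sum_add_distrib, Finset.sum_ite_mem, Finset.sum_ite_mem] at this
    simp only [Finset.univ_inter, Finset.sum_const, smul_eq_mul] at this
    have hw := h.weight
    rw [Finset.card_univ] at hw
    dsimp only
    omega

/-- The edges of `G` with both ends in `A`. -/
def edgesWithin (G : SimpleGraph V) (A : Finset V) : SimpleGraph V where
  Adj x y := G.Adj x y ∧ x ∈ A ∧ y ∈ A
  symm := ⟨fun _ _ h => ⟨h.1.symm, h.2.2, h.2.1⟩⟩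
  loopless := ⟨fun _ h => h.1.ne rfl⟩

lemma exists_dominatesEdges_of_reducible {G : SimpleGraph V}
    (h : ∀ A : Finset V, A.Nonempty → Reducible (edgesWithin G A) A) (A : Finset V) :
    ∃ M₂ M₁, DominatesEdges (edgesWithin G A) A M₂ M₁ := by
  classical
  induction A using Finset.strongInduction with
  | H A ih =>
    rcases A.eq_empty_or_nonempty with rfl | hA
    · exact ⟨∅, ∅, by simp, by simp, by simp, by simp⟩
    obtain ⟨R, hRA, hR, M₂, M₁, hM⟩ := h A hA
    obtain ⟨N₂, N₁, hN⟩ := ih (A \ R) (Finset.sdiff_ssubset hRA hR)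
    have hmono : ∀ e ∈ (edgesWithin G (A \ R)).edgeSet, e ∈ (edgesWithin G A).edgeSet := by
      intro e
      induction e using Sym2.ind with
      | _ x y => exact fun h => ⟨h.1, (Finset.mem_sdiff.1 h.2.1).1, (Finset.mem_sdiff.1 h.2.2).1⟩
    refine ⟨M₂ ∪ N₂, M₁ ∪ N₁, fun e he => ?_, fun e he => ?_, fun x hx y hxy => ?_, ?_⟩
    · rcases Finset.mem_union.1 he with he | he
      exacts [hM.sub₂ e he, hmono e (hN.sub₂ e he)]
    · rcases Finset.mem_union.1 he with he | he
      exacts [hM.sub₁ e he, hmono e (hN.sub₁ e he)]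
    · simp only [Finset.mem_union]
      by_cases hxR : x ∈ R
      · rcases hM.cover x hxR y hxy with h' | ⟨e, he, h'⟩
        exacts [Or.inl (Or.inl h'), Or.inr ⟨e, Or.inl he, h'⟩]
      by_cases hyR : y ∈ R
      · rcases hM.cover y hyR x hxy.symm with h' | ⟨e, he, h'⟩
        · rw [Sym2.eq_swap] at h'
          exact Or.inl (Or.inl h')
        · exact Or.inr ⟨e, Or.inl he, h'.symm⟩
      · rcases hN.cover x (Finset.mem_sdiff.2 ⟨hx, hxR⟩) y
          ⟨hxy.1, Finset.mem_sdiff.2 ⟨hx, hxR⟩, Finset.mem_sdiff.2 ⟨hxy.2.2, hyR⟩⟩ with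
          h' | ⟨e, he, h'⟩
        exacts [Or.inl (Or.inr h'), Or.inr ⟨e, Or.inr he, h'⟩]
    · have h1 := Finset.card_union_le M₂ N₂
      have h2 := Finset.card_union_le M₁ N₁
      have h3 := Finset.card_sdiff_add_card_eq_card hRA
      have h4 := hM.weight
      have h5 := hN.weight
      omega

variable {K : SimpleGraph V} {A : Finset V} (hA : ∀ x y, K.Adj x y → x ∈ A)

lemma reducible_of_isolated {z : V} (hz : z ∈ A) (h : ∀ y, ¬ K.Adj z y) : Reducible K A :=
  ⟨{z}, by simpa using hz, ⟨z, by simp⟩, ∅, ∅, by simp, by simp, by simpa using h, by simp⟩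

include hA

lemma reducible_of_dominating_list {R : List V} {P : List (Sym2 V)} (hR : R.Nodup)
    (hne : R ≠ []) (hK : ∀ x ∈ R, ∃ y, K.Adj x y) (hP : ∀ e ∈ P, e ∈ K.edgeSet)
    (hcover : ∀ x ∈ R, (∃ e ∈ P, x ∈ e) ∨ ∀ y, K.Adj x y → ∃ e ∈ P, y ∈ e)
    (hw : 10 * P.length ≤ 4 * R.length) : Reducible K A := by
  classical
  refine ⟨R.toFinset, fun x hx => ?_, ?_, P.toFinset, ∅, by simpa using hP, by simp,
    fun x hx y hxy => Or.inr ?_, ?_⟩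
  · obtain ⟨y, hxy⟩ := hK x (List.mem_toFinset.1 hx)
    exact hA x y hxy
  · simpa [List.toFinset_nonempty_iff] using hne
  · rcases hcover x (List.mem_toFinset.1 hx) with ⟨e, he, h⟩ | h
    · exact ⟨e, List.mem_toFinset.2 he, Or.inl h⟩
    · obtain ⟨e, he, h⟩ := h y hxy
      exact ⟨e, List.mem_toFinset.2 he, Or.inr h⟩
  · have := List.toFinset_card_le P
    rw [List.toFinset_card_of_nodup hR, Finset.card_empty]
    omega

lemma reducible_of_leaf {z u : V} (hzu : K.Adj z u) (h : ∀ y, K.Adj z y → y = u) :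
    Reducible K A := by
  classical
  by_cases hu : ∃ v, K.Adj u v ∧ v ≠ z
  · obtain ⟨v, huv, hvz⟩ := hu
    refine reducible_of_dominating_list hA (R := [z, u, v]) (P := [s(u, v)]) ?_ (by simp) ?_ ?_ ?_
      (by simp)
    · simpa using ⟨⟨hzu.ne, hvz.symm⟩, huv.ne⟩
    · simpa using ⟨⟨u, hzu⟩, ⟨v, huv⟩, u, huv.symm⟩
    · simpa using huv
    · simp only [List.mem_cons, List.not_mem_nil, or_false, forall_eq_or_imp, forall_eq,
        exists_eq_left, Sym2.mem_iff]
      exact ⟨Or.inr fun y hy => Or.inl (h y hy), by simp, by simp⟩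
  · push Not at hu
    refine ⟨{z, u}, ?_, by simp, ∅, {s(z, u)}, by simp, by simpa using hzu, ?_, ?_⟩
    · intro x hx
      simp only [Finset.mem_insert, Finset.mem_singleton] at hx
      rcases hx with rfl | rfl
      exacts [hA _ _ hzu, hA _ _ hzu.symm]
    · intro x hx y hxy
      simp only [Finset.mem_insert, Finset.mem_singleton] at hx
      left
      rcases hx with rfl | rfl
      · simp [h y hxy]
      · simp [hu y hxy]
    · simp [Finset.card_pair hzu.ne]

variable (htri : ∀ x y z, K.Adj x y → K.Adj y z → K.Adj z x → False)
  (hsq : ∀ x y z w, K.Adj x y → K.Adj y z → K.Adj z w → K.Adj w x → x ≠ z → y ≠ w → False)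

include htri hsq

lemma reducible_of_two_neighbors {z u v : V} (hzu : K.Adj z u) (hzv : K.Adj z v) (huv : u ≠ v)
    (h : ∀ y, K.Adj z y → y = u ∨ y = v) : Reducible K A := by
  by_cases hu : ∃ u', K.Adj u u' ∧ u' ≠ z
  swap
  · push Not at hu
    exact reducible_of_leaf hA hzu.symm hu
  by_cases hv : ∃ v', K.Adj v v' ∧ v' ≠ z
  swap
  · push Not at hv
    exact reducible_of_leaf hA hzv.symm hv
  obtain ⟨u', huu', hu'z⟩ := hu
  obtain ⟨v', hvv', hv'z⟩ := hv
  have n₁ : u' ≠ v := by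
    rintro rfl
    exact htri z u u' hzu huu' hzv.symm
  have n₂ : v' ≠ u := by
    rintro rfl
    exact htri z v v' hzv hvv' hzu.symm
  have n₃ : u' ≠ v' := by
    rintro rfl
    exact hsq z u u' v hzu huu' hvv'.symm hzv.symm hu'z.symm huv
  refine reducible_of_dominating_list hA (R := [z, u, v, u', v']) (P := [s(u, u'), s(v, v')]) ?_
    (by simp) ?_ ?_ ?_ (by simp)
  · simpa using ⟨⟨hzu.ne, hzv.ne, hu'z.symm, hv'z.symm⟩, ⟨huv, huu'.ne, n₂.symm⟩,
      ⟨n₁.symm, hvv'.ne⟩, n₃⟩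
  · simpa using ⟨⟨u, hzu⟩, ⟨u', huu'⟩, ⟨v', hvv'⟩, ⟨u, huu'.symm⟩, v, hvv'.symm⟩
  · simpa using ⟨huu', hvv'⟩
  · intro x hx
    simp only [List.mem_cons, List.not_mem_nil, or_false] at hx
    rcases hx with rfl | rfl | rfl | rfl | rfl
    · right
      intro y hy
      rcases h y hy with rfl | rfl <;> simp
    all_goals left; simp

lemma reducible_of_pentagon {z v y c a b d w : V} (hnd : [z, v, y, c, a].Nodup)
    (hzv : K.Adj z v) (hvy : K.Adj v y) (hyc : K.Adj y c) (hca : K.Adj c a) (haz : K.Adj a z)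
    (hzb : K.Adj z b) (hbv : b ≠ v) (hba : b ≠ a) (hz : ∀ t, K.Adj z t → t = v ∨ t = a ∨ t = b)
    (hyd : K.Adj y d) (hdv : d ≠ v) (hdc : d ≠ c) (hy : ∀ t, K.Adj y t → t = v ∨ t = c ∨ t = d)
    (hvw : K.Adj v w) (hwz : w ≠ z) (hwy : w ≠ y)
    (hb : ∀ q, ∃ p, K.Adj b p ∧ p ≠ z ∧ p ≠ q) (hd : ∃ q, K.Adj d q ∧ q ≠ y) :
    Reducible K A := by
  simp only [List.nodup_cons, List.mem_cons, List.not_mem_nil, or_false, not_or,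
    not_false_eq_true, List.nodup_nil, and_true] at hnd
  obtain ⟨⟨zv, zy, zc, za⟩, ⟨vy, vc, va⟩, ⟨yc, ya⟩, ca⟩ := hnd
  have nby : b ≠ y := by
    rintro rfl; exact htri z v b hzv hvy hzb.symm
  have bc : b ≠ c := by
    rintro rfl; exact htri z b a hzb hca haz
  have bd : b ≠ d := by
    rintro rfl; exact hsq z v y b hzv hvy hyd hzb.symm zy hbv.symm
  have dz : d ≠ z := by
    rintro rfl; exact htri d v y hzv hvy hyd
  have da : d ≠ a := by
    rintro rfl; exact htri y c d hyc hca hyd.symm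
  have wa : w ≠ a := by
    rintro rfl; exact htri z v w hzv hvw haz
  have wc : w ≠ c := by
    rintro rfl; exact htri v y w hvy hyc hvw.symm
  have wb : w ≠ b := by
    rintro rfl; exact htri z v w hzv hvw hzb.symm
  have wd : w ≠ d := by
    rintro rfl; exact htri v y w hvy hyd hvw.symm
  by_cases hbd : K.Adj b d
  · refine reducible_of_dominating_list hA (R := [z, y, a, c, v, w, b, d])
      (P := [s(a, c), s(v, w), s(b, d)]) ?_ (by simp) ?_ ?_ ?_ (by simp)
    · simpa using ⟨⟨zy, za, zc, zv, hwz.symm, hzb.ne, dz.symm⟩,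
        ⟨ya, yc, Ne.symm vy, hwy.symm, nby.symm, hyd.ne⟩,
        ⟨Ne.symm ca, Ne.symm va, wa.symm, hba.symm, da.symm⟩,
        ⟨Ne.symm vc, wc.symm, bc.symm, hdc.symm⟩, ⟨hvw.ne, hbv.symm, hdv.symm⟩, ⟨wb, wd⟩, bd⟩
    · simpa using ⟨⟨v, hzv⟩, ⟨d, hyd⟩, ⟨z, haz⟩, ⟨a, hca⟩, ⟨y, hvy⟩, ⟨v, hvw.symm⟩, ⟨d, hbd⟩,
        b, hbd.symm⟩
    · simpa using ⟨hca.symm, hvw, hbd⟩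
    · intro x hx
      simp only [List.mem_cons, List.not_mem_nil, or_false] at hx
      rcases hx with rfl | rfl | rfl | rfl | rfl | rfl | rfl | rfl
      · right
        intro t ht
        rcases hz t ht with rfl | rfl | rfl <;> simp
      · right
        intro t ht
        rcases hy t ht with rfl | rfl | rfl <;> simp
      all_goals left; simp
  · obtain ⟨q, hdq, qy⟩ := hd
    obtain ⟨p, hbp, pz, pq⟩ := hb q
    have py : p ≠ y := by
      rintro rfl; exact hsq z v p b hzv hvy hbp.symm hzb.symm zy hbv.symm
    have pa : p ≠ a := by
      rintro rfl; exact htri z b p hzb hbp haz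
    have pc : p ≠ c := by
      rintro rfl; exact hsq z a p b haz.symm hca.symm hbp.symm hzb.symm zc hba.symm
    have pv : p ≠ v := by
      rintro rfl; exact htri z b p hzb hbp hzv.symm
    have pw : p ≠ w := by
      rintro rfl; exact hsq z v p b hzv hvw hbp.symm hzb.symm hwz.symm hbv.symm
    have pd : p ≠ d := by
      rintro rfl; exact hbd hbp
    have qz : q ≠ z := by
      rintro rfl; exact hsq y v q d hvy.symm hzv.symm hdq.symm hyd.symm (Ne.symm zy) hdv.symm
    have qa : q ≠ a := by
      rintro rfl; exact hsq y c q d hyc hca hdq.symm hyd.symm ya hdc.symm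
    have qc : q ≠ c := by
      rintro rfl; exact htri y d q hyd hdq hyc.symm
    have qv : q ≠ v := by
      rintro rfl; exact htri y d q hyd hdq hvy
    have qw : q ≠ w := by
      rintro rfl; exact hsq y v q d hvy.symm hvw hdq.symm hyd.symm hwy.symm hdv.symm
    have qb : q ≠ b := by
      rintro rfl; exact hbd hdq.symm
    refine reducible_of_dominating_list hA (R := [z, y, a, c, v, w, b, p, d, q])
      (P := [s(a, c), s(v, w), s(b, p), s(d, q)]) ?_ (by simp) ?_ ?_ ?_ (by simp)
    · simpa using ⟨⟨zy, za, zc, zv, hwz.symm, hzb.ne, pz.symm, dz.symm, qz.symm⟩,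
        ⟨ya, yc, Ne.symm vy, hwy.symm, nby.symm, py.symm, hyd.ne, qy.symm⟩,
        ⟨Ne.symm ca, Ne.symm va, wa.symm, hba.symm, pa.symm, da.symm, qa.symm⟩,
        ⟨Ne.symm vc, wc.symm, bc.symm, pc.symm, hdc.symm, qc.symm⟩,
        ⟨hvw.ne, hbv.symm, pv.symm, hdv.symm, qv.symm⟩, ⟨wb, pw.symm, wd, qw.symm⟩,
        ⟨hbp.ne, bd, qb.symm⟩, ⟨pd, pq⟩, hdq.ne⟩
    · simpa using ⟨⟨v, hzv⟩, ⟨d, hyd⟩, ⟨z, haz⟩, ⟨a, hca⟩, ⟨y, hvy⟩, ⟨v, hvw.symm⟩, ⟨p, hbp⟩,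
        ⟨b, hbp.symm⟩, ⟨q, hdq⟩, d, hdq.symm⟩
    · simpa using ⟨hca.symm, hvw, hbp, hdq⟩
    · intro x hx
      simp only [List.mem_cons, List.not_mem_nil, or_false] at hx
      rcases hx with rfl | rfl | rfl | rfl | rfl | rfl | rfl | rfl | rfl | rfl
      · right
        intro t ht
        rcases hz t ht with rfl | rfl | rfl <;> simp
      · right
        intro t ht
        rcases hy t ht with rfl | rfl | rfl <;> simp
      all_goals left; simp

omit hA htri hsq in
open Classical in
lemma exists_third_neighbor [Fintype V] {x u v : V} (h : K.degree x = 3) (hu : K.Adj x u)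
    (hv : K.Adj x v) (huv : u ≠ v) :
    ∃ w, K.Adj x w ∧ w ≠ u ∧ w ≠ v ∧ ∀ t, K.Adj x t → t = u ∨ t = v ∨ t = w := by
  rw [← K.card_neighborFinset_eq_degree] at h
  have h1 : (((K.neighborFinset x).erase u).erase v).card = 1 := by
    rw [Finset.card_erase_of_mem, Finset.card_erase_of_mem, h]
    · simpa using hu
    · simpa using ⟨huv.symm, hv⟩
  obtain ⟨w, hw⟩ := Finset.card_eq_one.1 h1
  have key : ∀ t, t ∈ ((K.neighborFinset x).erase u).erase v ↔ t = w := by simp [hw]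
  simp only [Finset.mem_erase, mem_neighborFinset] at key
  have hw' := (key w).2 rfl
  refine ⟨w, hw'.2.2, hw'.2.1, hw'.1, fun t ht => ?_⟩
  have := key t
  tauto

theorem reducible_of_planar [Fintype V] (hne : A.Nonempty)
    (hK33 : ¬ HasMinor K (completeBipartiteGraph (Fin 3) (Fin 3)))
    (hK5 : ¬ HasMinor K (completeGraph (Fin 5))) : Reducible K A := by
  classical
  obtain ⟨z, hz⟩ := hne
  by_cases hiso : ∃ u, K.Adj z u
  swap
  · exact reducible_of_isolated hz (not_exists.1 hiso)
  obtain ⟨u, hzu⟩ := hiso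
  by_contra hred
  have hthree : ∀ x y, K.Adj x y → ∀ r s, ∃ t, K.Adj x t ∧ t ≠ r ∧ t ≠ s := by
    intro x y hxy r s
    by_contra! hcon
    by_cases h1 : ∃ t, K.Adj x t ∧ t ≠ y
    · obtain ⟨t, hxt, hty⟩ := h1
      refine hred (reducible_of_two_neighbors hA htri hsq hxy hxt hty.symm fun q hxq => ?_)
      exact eq_or_eq_of_two_values (hcon y hxy) (hcon t hxt) (hcon q hxq) hty
    · push Not at h1
      exact hred (reducible_of_leaf hA hxy h1)
  have hdeg : ∀ x y, K.Adj x y → 3 ≤ K.degree x := by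
    intro x y hxy
    obtain ⟨t, hxt, hty, -⟩ := hthree x y hxy y y
    obtain ⟨q, hxq, hqy, hqt⟩ := hthree x y hxy y t
    rw [← K.card_neighborFinset_eq_degree, ← Finset.card_eq_three.2 ⟨y, t, q, hty.symm, hqy.symm,
      hqt.symm, rfl⟩]
    refine Finset.card_le_card fun p hp => ?_
    simp only [Finset.mem_insert, Finset.mem_singleton] at hp
    rw [mem_neighborFinset]
    rcases hp with rfl | rfl | rfl <;> assumption
  obtain ⟨x₀, x₁, x₂, x₃, x₄, hnd, h₀, h₁, h₂, h₃, h₄, d₀, d₂⟩ :=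
    exists_pentagon htri hsq hK33 hK5 hdeg hzu
  have n₁ : x₁ ≠ x₄ := by
    rintro rfl; simp at hnd
  have n₂ : x₁ ≠ x₃ := by
    rintro rfl; simp at hnd
  obtain ⟨b, hb, hb₁, hb₄, hb'⟩ := exists_third_neighbor d₀ h₀ h₄.symm n₁
  obtain ⟨d, hd, hd₁, hd₃, hd'⟩ := exists_third_neighbor d₂ h₁.symm h₂ n₂
  obtain ⟨w, hw, hw₀, hw₂⟩ := hthree x₁ x₂ h₁ x₀ x₂
  obtain ⟨q, hq, hq₂, -⟩ := hthree d x₂ hd.symm x₂ x₂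
  exact hred (reducible_of_pentagon hA htri hsq hnd h₀ h₁ h₂ h₃ h₄ hb hb₁ hb₄ hb' hd hd₁ hd₃ hd' hw
    hw₀ hw₂ (fun q => hthree b x₀ hb.symm x₀ q) ⟨q, hq, hq₂⟩)

end Reduction

lemma HasMinor.mono {V U : Type*} {G G' : SimpleGraph V} {H : SimpleGraph U} (hG : G ≤ G')
    (h : HasMinor G H) : HasMinor G' H := by
  obtain ⟨S, hc, hd, ha⟩ := h
  refine ⟨S, fun u => (hc u).mono_graph fun x _ y _ hxy => hG hxy, hd, fun u w huw => ?_⟩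
  obtain ⟨x, hx, y, hy, hxy⟩ := ha u w huw
  exact ⟨x, hx, y, hy, hG hxy⟩

lemma SimpleGraph.not_triangle_of_egirth {V : Type*} {G : SimpleGraph V} (h : 5 ≤ G.egirth)
    (x y z : V) (h₁ : G.Adj x y) (h₂ : G.Adj y z) (h₃ : G.Adj z x) : False := by
  have hc : (Walk.cons h₁ (.cons h₂ (.cons h₃ .nil))).IsCycle := by
    rw [Walk.isCycle_def]
    have := h₁.ne
    have := h₂.ne
    have := h₃.ne
    refine ⟨?_, by simp, ?_⟩
    · rw [Walk.isTrail_def]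
      simp
      grind
    · simp
      grind
  have := le_egirth.1 h _ _ hc
  simp at this
  exact absurd this (by decide)

lemma SimpleGraph.not_square_of_egirth {V : Type*} {G : SimpleGraph V} (h : 5 ≤ G.egirth)
    (x y z w : V) (h₁ : G.Adj x y) (h₂ : G.Adj y z) (h₃ : G.Adj z w) (h₄ : G.Adj w x)
    (hxz : x ≠ z) (hyw : y ≠ w) : False := by
  have hc : (Walk.cons h₁ (.cons h₂ (.cons h₃ (.cons h₄ .nil)))).IsCycle := by
    rw [Walk.isCycle_def]
    have := h₁.ne
    have := h₂.ne
    have := h₃.ne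
    have := h₄.ne
    refine ⟨?_, by simp, ?_⟩
    · rw [Walk.isTrail_def]
      simp
      grind
    · simp
      grind
  have := le_egirth.1 h _ _ hc
  simp at this
  exact absurd this (by decide)

/-- If `G` is a planar graph on `n` vertices (planarity taken in the Kuratowski form)
with girth at least 5, then `γ'_R(G) ≤ (4/5)·n`. -/
theorem edgeRomanNumber_le_of_planar_girth_five {V : Type*} [Fintype V] [DecidableEq V]
    (G : SimpleGraph V)
    (hK5 : ¬ ContainsSubdivision G (completeGraph (Fin 5)))
    (hK33 : ¬ ContainsSubdivision G (completeBipartiteGraph (Fin 3) (Fin 3)))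
    (hgirth : 5 ≤ G.egirth) :
    (edgeRomanNumber V G : ℝ) ≤ 4 / 5 * Fintype.card V := by
  have hle : ∀ A : Finset V, edgesWithin G A ≤ G := fun A x y h => h.1
  obtain ⟨M₂, M₁, hM⟩ := exists_dominatesEdges_of_reducible (G := G) (fun A hA =>
    reducible_of_planar (fun x y h => h.2.1)
      (fun x y z h₁ h₂ h₃ => not_triangle_of_egirth hgirth x y z h₁.1 h₂.1 h₃.1)
      (fun x y z w h₁ h₂ h₃ h₄ => not_square_of_egirth hgirth x y z w h₁.1 h₂.1 h₃.1 h₄.1) hA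
      (fun h => hK33 (h.mono (hle A)).containsSubdivision_K33)
      (fun h => (h.mono (hle A)).containsSubdivision_K5.elim hK5 hK33)) univ
  have huniv : edgesWithin G univ = G := by
    ext x y
    simp [edgesWithin]
  rw [huniv] at hM
  obtain ⟨f, hf, hw⟩ := EdgeRDF.exists_of_dominatesEdges hM
  have h : edgeRomanNumber V G ≤ ∑ e : Sym2 V, f e := Nat.sInf_le ⟨f, hf, rfl⟩
  have h' : 5 * edgeRomanNumber V G ≤ 4 * Fintype.card V := by omega
  have h'' : (5 : ℝ) * edgeRomanNumber V G ≤ 4 * Fintype.card V := by exact_mod_cast h'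
  linarith
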